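/- As n → ∞, pa_o(n) is asymptotically equal to (√A/(2πn))·e^{2√(An)}, where A = π²/12 + 2(log((1+√5)/2))²; consequently pa_o(n)/pa(n) → 1 as n → ∞, i.e., unlimited parity alternating partitions are dominated by those whose smallest part is odd. -/

import Mathlib

open Filter Topology

/-- A partition is (unlimited) parity alternating if any two consecutive distinct part
sizes have opposite parity. -/
def ParityAlternating {n : ℕ} (p : n.Partition) : Prop :=
  ∀ a ∈ p.parts, ∀ b ∈ p.parts, a < b →
    (∀ c ∈ p.parts, ¬(a < c ∧ c < b)) → (Odd a ↔ Even b)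

/-- The smallest part of the partition is odd. -/
def SmallestPartOdd {n : ℕ} (p : n.Partition) : Prop :=
  ∃ a ∈ p.parts, Odd a ∧ ∀ b ∈ p.parts, a ≤ b

/-- The number of unlimited parity alternating partitions of `n`. -/
noncomputable def pa (n : ℕ) : ℕ := Nat.card {p : n.Partition // ParityAlternating p}

/-- The number of unlimited parity alternating partitions of `n` whose smallest part is odd. -/
noncomputable def paOdd (n : ℕ) : ℕ :=
  Nat.card {p : n.Partition // ParityAlternating p ∧ SmallestPartOdd p}

/-- Parity alternation for multisets. -/
def PAm (M : Multiset ℕ) : Prop :=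
  ∀ a ∈ M, ∀ b ∈ M, a < b → (∀ c ∈ M, ¬(a < c ∧ c < b)) → (Odd a ↔ Even b)

/-- Add `d` to all the parts of `0 ::ₘ M`. -/
def shiftM (d : ℕ) (M : Multiset ℕ) : Multiset ℕ := (0 ::ₘ M).map (· + d)

lemma mem_shiftM {d : ℕ} {M : Multiset ℕ} {x : ℕ} :
    x ∈ shiftM d M ↔ ∃ y ∈ (0 ::ₘ M), y + d = x := by
  rw [shiftM, Multiset.mem_map]

lemma self_mem_shiftM (d : ℕ) (M : Multiset ℕ) : d ∈ shiftM d M :=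
  mem_shiftM.2 ⟨0, by simp, by simp⟩

lemma le_of_mem_shiftM {d : ℕ} {M : Multiset ℕ} {x : ℕ} (h : x ∈ shiftM d M) : d ≤ x := by
  obtain ⟨y, _, rfl⟩ := mem_shiftM.1 h; omega

lemma card_shiftM (d : ℕ) (M : Multiset ℕ) : (shiftM d M).card = M.card + 1 := by
  simp [shiftM]

lemma sum_shiftM (d : ℕ) (M : Multiset ℕ) :
    (shiftM d M).sum = (M.card + 1) * d + M.sum := by
  simp [shiftM, Multiset.sum_map_add]; ring

lemma shiftM_inj {d d' : ℕ} {M M' : Multiset ℕ} (h : shiftM d M = shiftM d' M') :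
    d = d' ∧ M = M' := by
  have h1 : d = d' := by
    apply le_antisymm
    · apply le_of_mem_shiftM (M := M); rw [h]; exact self_mem_shiftM _ _
    · apply le_of_mem_shiftM (M := M'); rw [← h]; exact self_mem_shiftM _ _
  subst h1
  refine ⟨rfl, ?_⟩
  have := Multiset.map_injective (add_left_injective d) h
  simpa using this

lemma exists_shiftM {M : Multiset ℕ} {a : ℕ} (ha : a ∈ M) (hmin : ∀ b ∈ M, a ≤ b) :
    ∃ M', M = shiftM a M' := by
  have h0 : (0 : ℕ) ∈ M.map (· - a) := Multiset.mem_map.2 ⟨a, ha, by simp⟩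
  obtain ⟨M', hM'⟩ := Multiset.exists_cons_of_mem h0
  refine ⟨M', ?_⟩
  rw [shiftM, ← hM', Multiset.map_map]
  conv_lhs => rw [← Multiset.map_id M]
  apply Multiset.map_congr rfl
  intro x hx
  have := hmin x hx
  simp; omega

lemma exists_min {M : Multiset ℕ} (h : 0 < M.card) : ∃ a ∈ M, ∀ b ∈ M, a ≤ b := by
  obtain ⟨x, hx⟩ := Multiset.card_pos_iff_exists_mem.1 h
  classical
  have hne : M.toFinset.Nonempty := ⟨x, by simpa using hx⟩
  refine ⟨M.toFinset.min' hne, by simpa using M.toFinset.min'_mem hne, fun b hb => ?_⟩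
  exact M.toFinset.min'_le b (by simpa using hb)

lemma PAm_shiftM {d : ℕ} {M : Multiset ℕ} : PAm (shiftM d M) ↔ PAm (0 ::ₘ M) := by
  have key : ∀ a b : ℕ, (Odd (a + d) ↔ Even (b + d)) ↔ (Odd a ↔ Even b) := by
    intro a b
    grind
  constructor
  · intro h a ha b hb hab hc
    rw [← key]
    refine h _ (mem_shiftM.2 ⟨a, ha, rfl⟩) _ (mem_shiftM.2 ⟨b, hb, rfl⟩) (by omega) ?_
    intro c hcm
    obtain ⟨c', hc', rfl⟩ := mem_shiftM.1 hcm
    have := hc c' hc'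
    omega
  · intro h a ha b hb hab hc
    obtain ⟨a', ha', rfl⟩ := mem_shiftM.1 ha
    obtain ⟨b', hb', rfl⟩ := mem_shiftM.1 hb
    rw [key]
    refine h a' ha' b' hb' (by omega) ?_
    intro c hcm
    have := hc _ (mem_shiftM.2 ⟨c, hcm, rfl⟩)
    omega

lemma PAm_cons_shiftM {d : ℕ} {M : Multiset ℕ} :
    PAm (0 ::ₘ shiftM d M) ↔ (d = 0 ∨ Odd d) ∧ PAm (0 ::ₘ M) := by
  rcases Nat.eq_zero_or_pos d with rfl | hd
  · have h0 : (0 : ℕ) ∈ shiftM 0 M := self_mem_shiftM 0 M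
    have : PAm (0 ::ₘ shiftM 0 M) ↔ PAm (shiftM 0 M) := by
      have hm : ∀ x, x ∈ (0 ::ₘ shiftM 0 M) ↔ x ∈ shiftM 0 M := by
        intro x; rw [Multiset.mem_cons]; constructor
        · rintro (rfl | h); exacts [h0, h]
        · exact Or.inr
      simp only [PAm, hm]
    rw [this, PAm_shiftM]; simp
  · rw [← PAm_shiftM (d := d) (M := M)]
    constructor
    · intro h
      refine ⟨Or.inr ?_, ?_⟩
      · have := h 0 (by simp) d (by simp [self_mem_shiftM]) hd (by
          intro c hc
          rcases Multiset.mem_cons.1 hc with rfl | hc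
          · omega
          · have := le_of_mem_shiftM hc; omega)
        simpa using this
      · intro a ha b hb hab hc
        refine h a (by simp [ha]) b (by simp [hb]) hab ?_
        intro c hcm
        rcases Multiset.mem_cons.1 hcm with rfl | hcm
        · omega
        · exact hc c hcm
    · rintro ⟨hd', h⟩ a ha b hb hab hc
      rcases Multiset.mem_cons.1 hb with rfl | hb
      · omega
      rcases Multiset.mem_cons.1 ha with rfl | ha
      · have hdb : d = b := by
          have := le_of_mem_shiftM hb
          have := hc d (by simp [self_mem_shiftM])
          omega
        subst hdb
        have : Odd d := by rcases hd' with h | h; omega; exact h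
        simpa using this
      · refine h a ha b hb hab ?_
        intro c hcm
        exact hc c (by simp [hcm])

/-- Multisets of size `m` (zeros allowed), alternating together with `0`. -/
abbrev XM (m : ℕ) := {M : Multiset ℕ // M.card = m ∧ PAm (0 ::ₘ M)}

/-- The `k`-th factor. -/
noncomputable def fac (q : ℂ) (k : ℕ) : ℂ := 1 + q ^ k / (1 - q ^ (2 * k))

/-- Finite products. -/
noncomputable def PP (q : ℂ) (m : ℕ) : ℂ := ∏ k ∈ Finset.range m, fac q (k + 1)

/-- The recursive equivalence. -/
noncomputable def XMequiv (m : ℕ) : {d : ℕ // d = 0 ∨ Odd d} × XM m ≃ XM (m + 1) :=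
  Equiv.ofBijective (fun x => ⟨shiftM x.1.1 x.2.1, by
    rw [card_shiftM, x.2.2.1], PAm_cons_shiftM.2 ⟨x.1.2, x.2.2.2⟩⟩) (by
  constructor
  · rintro ⟨⟨d, hd⟩, ⟨M, hM⟩⟩ ⟨⟨d', hd'⟩, ⟨M', hM'⟩⟩ h
    obtain ⟨rfl, rfl⟩ := shiftM_inj (congrArg Subtype.val h)
    rfl
  · rintro ⟨M, hM, hP⟩
    obtain ⟨a, ha, hmin⟩ := exists_min (M := M) (by omega)
    obtain ⟨M', rfl⟩ := exists_shiftM ha hmin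
    rw [PAm_cons_shiftM] at hP
    rw [card_shiftM] at hM
    exact ⟨⟨⟨a, hP.1⟩, ⟨M', by omega, hP.2⟩⟩, rfl⟩)

lemma hasSum_odd {x : ℂ} (hx : ‖x‖ < 1) :
    HasSum (fun d : {d : ℕ // Odd d} => x ^ d.1) (x / (1 - x ^ 2)) := by
  have h2 : ‖x ^ 2‖ < 1 := by rw [norm_pow]; exact pow_lt_one₀ (norm_nonneg _) hx (by norm_num)
  have h := (hasSum_geometric_of_norm_lt_one h2).mul_left x
  let e : ℕ ≃ {d : ℕ // Odd d} := Equiv.ofBijective (fun j => ⟨2 * j + 1, by simp⟩) (by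
    constructor
    · intro a b h
      have := congrArg Subtype.val h
      simpa using this
    · rintro ⟨d, hd⟩
      obtain ⟨k, rfl⟩ := hd
      exact ⟨k, rfl⟩)
  rw [← e.hasSum_iff]
  convert! h using 1
  ext j
  have he : (e j).1 = 2 * j + 1 := rfl
  rw [Function.comp, he]; ring

lemma hasSum_even {x : ℂ} (hx : ‖x‖ < 1) :
    HasSum (fun d : {d : ℕ // 0 < d ∧ Even d} => x ^ d.1) (x ^ 2 / (1 - x ^ 2)) := by
  have h2 : ‖x ^ 2‖ < 1 := by rw [norm_pow]; exact pow_lt_one₀ (norm_nonneg _) hx (by norm_num)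
  have h := (hasSum_geometric_of_norm_lt_one h2).mul_left (x ^ 2)
  let e : ℕ ≃ {d : ℕ // 0 < d ∧ Even d} :=
    Equiv.ofBijective (fun j => ⟨2 * j + 2, by omega, ⟨j + 1, by ring⟩⟩) (by
    constructor
    · intro a b h
      have := congrArg Subtype.val h
      simpa using this
    · rintro ⟨d, hd0, hd⟩
      obtain ⟨k, rfl⟩ := hd
      exact ⟨k - 1, Subtype.ext (by simp; omega)⟩)
  rw [← e.hasSum_iff]
  convert! h using 1
  ext j
  have he : (e j).1 = 2 * j + 2 := rfl
  rw [Function.comp, he]; ring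

lemma hasSum_zero_odd {x : ℂ} (hx : ‖x‖ < 1) :
    HasSum (fun d : {d : ℕ // d = 0 ∨ Odd d} => x ^ d.1) (1 + x / (1 - x ^ 2)) := by
  have h0 : HasSum (fun d : {d : ℕ // d = 0} => x ^ d.1) 1 := by
    have := hasSum_unique (fun d : {d : ℕ // d = 0} => x ^ d.1)
    convert this using 1
    have : (default : {d : ℕ // d = 0}).1 = 0 := (default : {d : ℕ // d = 0}).2
    rw [this]; simp
  have h1 := hasSum_odd hx
  exact HasSum.add_disjoint (s := {d : ℕ | d = 0}) (t := {d : ℕ | Odd d}) (f := fun d => x ^ d)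
    (by rw [Set.disjoint_left]; rintro a (rfl : a = 0) h; simp at h) h0 h1

lemma hasSum_XM {q : ℂ} (hq : ‖q‖ < 1) (m : ℕ) :
    HasSum (fun M : XM m => q ^ M.1.sum) (PP q m) ∧ Summable (fun M : XM m => ‖q‖ ^ M.1.sum) := by
  induction m with
  | zero =>
    have : Unique (XM 0) := ⟨⟨⟨0, by simp, by intro a ha b hb; simp at ha hb; omega⟩⟩, by
      rintro ⟨M, hM, _⟩
      simpa using hM⟩
    have hd : ∀ M : XM 0, M.1 = 0 := fun M => by simpa using M.2.1
    constructor
    · have := hasSum_unique (fun M : XM 0 => q ^ M.1.sum)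
      rw [hd] at this
      simpa [PP] using this
    · exact (hasSum_unique (fun M : XM 0 => ‖q‖ ^ M.1.sum)).summable
  | succ m ih =>
    have hx : ‖q ^ (m + 1)‖ < 1 := by
      rw [norm_pow]; exact pow_lt_one₀ (norm_nonneg _) hq (by norm_num)
    have h1 := hasSum_zero_odd hx
    have h1' : Summable (fun d : {d : ℕ // d = 0 ∨ Odd d} => ‖(q ^ (m + 1)) ^ d.1‖) := by
      have h := ((summable_geometric_of_lt_one (norm_nonneg _) hx).subtype
        {d : ℕ | d = 0 ∨ Odd d})
      simp only [norm_pow] at h ⊢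
      exact h
    have h2' : Summable (fun M : XM m => ‖q ^ M.1.sum‖) := by simpa [norm_pow] using ih.2
    have hprodn := Summable.mul_norm h1' h2'
    have hs := h1.mul ih.1 hprodn.of_norm
    have hsum : ∀ x : {d : ℕ // d = 0 ∨ Odd d} × XM m,
        q ^ ((XMequiv m) x).1.sum = (q ^ (m + 1)) ^ x.1.1 * q ^ x.2.1.sum := by
      intro x
      have : ((XMequiv m) x).1 = shiftM x.1.1 x.2.1 := rfl
      rw [this, sum_shiftM, x.2.2.1, pow_add, pow_mul]
    constructor
    · rw [← (XMequiv m).hasSum_iff]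
      convert! hs using 1
      · ext x; exact hsum x
      · rw [PP, Finset.prod_range_succ, mul_comm]
        congr 1
        rw [fac, ← pow_mul, mul_comm (m + 1) 2]
    · rw [← (XMequiv m).summable_iff]
      convert! hprodn using 1
      ext x
      rw [← hsum x, norm_pow]; rfl

/-- Smallest part satisfies `E`. -/
abbrev ZM (E : ℕ → Prop) := {M : Multiset ℕ // (∀ x ∈ M, 0 < x) ∧ PAm M ∧
  ∃ a ∈ M, E a ∧ ∀ b ∈ M, a ≤ b}

/-- The decomposition according to the number of parts and the smallest part. -/
noncomputable def ZMequiv (E : ℕ → Prop) :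
    (Σ m : ℕ, {d : ℕ // 0 < d ∧ E d} × XM m) ≃ ZM E :=
  Equiv.ofBijective (fun x => ⟨shiftM x.2.1.1 x.2.2.1, fun y hy =>
    lt_of_lt_of_le x.2.1.2.1 (le_of_mem_shiftM hy), PAm_shiftM.2 x.2.2.2.2,
    ⟨x.2.1.1, self_mem_shiftM _ _, x.2.1.2.2, fun b hb => le_of_mem_shiftM hb⟩⟩) (by
  constructor
  · rintro ⟨m, ⟨d, hd⟩, ⟨M, hM⟩⟩ ⟨m', ⟨d', hd'⟩, ⟨M', hM'⟩⟩ h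
    obtain ⟨rfl, rfl⟩ := shiftM_inj (congrArg Subtype.val h)
    obtain ⟨rfl, _⟩ := hM
    obtain ⟨rfl, _⟩ := hM'
    rfl
  · rintro ⟨M, hpos, hP, a, ha, hE, hmin⟩
    obtain ⟨M', rfl⟩ := exists_shiftM ha hmin
    exact ⟨⟨M'.card, ⟨a, hpos a ha, hE⟩, ⟨M', rfl, PAm_shiftM.1 hP⟩⟩, rfl⟩)

/-- Number of parity alternating partitions with smallest part satisfying `E`. -/
noncomputable def paE (E : ℕ → Prop) (n : ℕ) : ℕ :=
  Nat.card {p : n.Partition // ParityAlternating p ∧ ∃ a ∈ p.parts, E a ∧ ∀ b ∈ p.parts, a ≤ b}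

/-- Fibers are partitions. -/
def fiberEquiv (E : ℕ → Prop) (n : ℕ) : {z : ZM E // z.1.sum = n} ≃
    {p : n.Partition // ParityAlternating p ∧ ∃ a ∈ p.parts, E a ∧ ∀ b ∈ p.parts, a ≤ b} where
  toFun z := ⟨⟨z.1.1, fun {i} hi => z.1.2.1 i hi, z.2⟩, z.1.2.2.1, z.1.2.2.2⟩
  invFun p := ⟨⟨p.1.parts, fun x hx => p.1.parts_pos hx, p.2.1, p.2.2⟩, p.1.parts_sum⟩
  left_inv z := rfl
  right_inv p := rfl

lemma hasSum_paE {E : ℕ → Prop} {q : ℂ} {g : ℂ → ℂ} (hq : ‖q‖ < 1)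
    (hg : ∀ x : ℂ, ‖x‖ < 1 → HasSum (fun d : {d : ℕ // 0 < d ∧ E d} => x ^ d.1) (g x))
    (hs : Summable (fun m : ℕ => g ((‖q‖ : ℂ) ^ (m + 1)) * PP (‖q‖ : ℂ) m)) :
    HasSum (fun n => (paE E n : ℂ) * q ^ n) (∑' m, g (q ^ (m + 1)) * PP q m) ∧
    Summable (fun n => (paE E n : ℝ) * ‖q‖ ^ n) := by
  have inner : ∀ y : ℂ, ‖y‖ < 1 → ∀ m : ℕ, HasSum (fun x : {d : ℕ // 0 < d ∧ E d} × XM m =>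
      y ^ (shiftM x.1.1 x.2.1).sum) (g (y ^ (m + 1)) * PP y m) ∧
      Summable (fun x : {d : ℕ // 0 < d ∧ E d} × XM m => ‖y‖ ^ (shiftM x.1.1 x.2.1).sum) := by
    intro y hy m
    have hx : ‖y ^ (m + 1)‖ < 1 := by
      rw [norm_pow]; exact pow_lt_one₀ (norm_nonneg _) hy (by norm_num)
    have h1 := hg _ hx
    have h1' : Summable (fun d : {d : ℕ // 0 < d ∧ E d} => ‖(y ^ (m + 1)) ^ d.1‖) := by
      have h := ((summable_geometric_of_lt_one (norm_nonneg _) hx).subtype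
        {d : ℕ | 0 < d ∧ E d})
      simp only [norm_pow] at h ⊢
      exact h
    have h2 := hasSum_XM hy m
    have h2' : Summable (fun M : XM m => ‖y ^ M.1.sum‖) := by simpa [norm_pow] using h2.2
    have hprodn := Summable.mul_norm h1' h2'
    have hs := h1.mul h2.1 hprodn.of_norm
    have hsum : ∀ x : {d : ℕ // 0 < d ∧ E d} × XM m,
        y ^ (shiftM x.1.1 x.2.1).sum = (y ^ (m + 1)) ^ x.1.1 * y ^ x.2.1.sum := by
      intro x
      rw [sum_shiftM, x.2.2.1, pow_add, pow_mul]
    constructor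
    · convert! hs using 1
      ext x; exact hsum x
    · convert! hprodn using 1
      ext x
      rw [← hsum x, norm_pow]
  have hnn : ‖((‖q‖ : ℝ) : ℂ)‖ = ‖q‖ := by simp
  have S1 : Summable (fun x : (Σ m : ℕ, {d : ℕ // 0 < d ∧ E d} × XM m) =>
      ‖q‖ ^ (shiftM x.2.1.1 x.2.2.1).sum) := by
    rw [summable_sigma_of_nonneg (fun _ => by positivity)]
    refine ⟨fun m => (inner q hq m).2, ?_⟩
    have := fun m => (inner ((‖q‖ : ℝ) : ℂ) (by rw [hnn]; exact hq) m).1.tsum_eq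
    rw [← Complex.summable_ofReal]
    convert! hs using 1
    ext m
    rw [← this m]
    push_cast
    rfl
  have S2 : Summable (fun z : ZM E => ‖q‖ ^ z.1.sum) := by
    rw [← (ZMequiv E).summable_iff]; exact S1
  have H1 : HasSum (fun z : ZM E => q ^ z.1.sum) (∑' m, g (q ^ (m + 1)) * PP q m) := by
    rw [← (ZMequiv E).hasSum_iff]
    have hsm : Summable (fun x : (Σ m : ℕ, {d : ℕ // 0 < d ∧ E d} × XM m) =>
      q ^ (shiftM x.2.1.1 x.2.2.1).sum) := Summable.of_norm (by simpa [norm_pow] using S1)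
    have h := hsm.hasSum
    have h2 := h.sigma (fun m => (inner q hq m).1)
    rw [h2.tsum_eq]
    exact h
  have hfin : ∀ n, Finite {z : ZM E // z.1.sum = n} := fun n =>
    Finite.of_equiv _ (fiberEquiv E n).symm
  have hcard : ∀ n, Nat.card {z : ZM E // z.1.sum = n} = paE E n := fun n =>
    Nat.card_congr (fiberEquiv E n)
  let e := Equiv.sigmaFiberEquiv (fun z : ZM E => z.1.sum)
  constructor
  · have H2 := (e.hasSum_iff).2 H1
    refine H2.sigma (fun n => ?_)
    have := hfin n
    have : Fintype {z : ZM E // z.1.sum = n} := Fintype.ofFinite _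
    have hh := hasSum_fintype (fun c : {z : ZM E // z.1.sum = n} =>
      ((fun z : ZM E => q ^ z.1.sum) ∘ e) ⟨n, c⟩)
    convert! hh using 1
    rw [← hcard n, Nat.card_eq_fintype_card, Finset.sum_congr rfl (g := fun _ => q ^ n)]
    · simp
    · rintro ⟨z, hz⟩ _
      simp [e, hz]
  · have H2 := (e.summable_iff).2 S2
    have H3 := H2.sigma
    convert! H3 using 1
    ext n
    have := hfin n
    have : Fintype {z : ZM E // z.1.sum = n} := Fintype.ofFinite _
    rw [tsum_fintype, ← hcard n, Nat.card_eq_fintype_card,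
      Finset.sum_congr rfl (g := fun _ => ‖q‖ ^ n)]
    · simp
    · rintro ⟨z, hz⟩ _
      simp [e, hz]

lemma paOdd_eq (n : ℕ) : paOdd n = paE Odd n := rfl

lemma pa_eq {n : ℕ} (hn : 0 < n) : pa n = paE Odd n + paE Even n := by
  classical
  rw [pa, paE, paE]
  rw [← Nat.card_sum]
  symm
  have hdis : ∀ p : n.Partition, (∃ a ∈ p.parts, Odd a ∧ ∀ b ∈ p.parts, a ≤ b) →
      ¬ (∃ a ∈ p.parts, Even a ∧ ∀ b ∈ p.parts, a ≤ b) := by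
    rintro p ⟨a, ha, ho, h⟩ ⟨b, hb, he, h'⟩
    have : a = b := le_antisymm (h b hb) (h' a ha)
    subst this
    exact (Nat.not_even_iff_odd.2 ho) he
  refine Nat.card_congr (Equiv.ofBijective (fun x => x.elim (fun p => ⟨p.1, p.2.1⟩)
    (fun p => ⟨p.1, p.2.1⟩)) ⟨?_, ?_⟩)
  · rintro (⟨p, hp⟩ | ⟨p, hp⟩) (⟨p', hp'⟩ | ⟨p', hp'⟩) h <;>
      have h' := congrArg Subtype.val h <;> simp at h' <;> subst h'
    · rfl
    · exact absurd hp'.2 (hdis _ hp.2)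
    · exact absurd hp.2 (hdis _ hp'.2)
    · rfl
  · rintro ⟨p, hp⟩
    have hc : 0 < p.parts.card := by
      rw [Multiset.card_pos]; rintro h
      have := p.parts_sum; rw [h] at this; simp at this; omega
    obtain ⟨a, ha, hmin⟩ := exists_min hc
    rcases Nat.even_or_odd a with h | h
    · exact ⟨Sum.inr ⟨p, hp, a, ha, h, hmin⟩, rfl⟩
    · exact ⟨Sum.inl ⟨p, hp, a, ha, h, hmin⟩, rfl⟩


/-- Real factor. -/
noncomputable def facR (r : ℝ) (k : ℕ) : ℝ := 1 + r ^ k / (1 - r ^ (2 * k))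

/-- Real products. -/
noncomputable def PR (r : ℝ) (m : ℕ) : ℝ := ∏ k ∈ Finset.range m, facR r (k + 1)

lemma PP_ofReal (r : ℝ) (m : ℕ) : PP (r : ℂ) m = (PR r m : ℂ) := by
  simp [PP, PR, fac, facR]

lemma pow_facts {r : ℝ} (h0 : 0 < r) (h1 : r < 1) {k : ℕ} (hk : 1 ≤ k) :
    0 < r ^ k ∧ r ^ k < 1 ∧ r ^ (2 * k) = (r ^ k) ^ 2 ∧ r ^ k ≤ r := by
  refine ⟨by positivity, pow_lt_one₀ h0.le h1 (by omega), by rw [mul_comm, pow_mul], ?_⟩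
  calc r ^ k ≤ r ^ 1 := pow_le_pow_of_le_one h0.le h1.le hk
    _ = r := pow_one r

lemma one_le_facR {r : ℝ} (h0 : 0 < r) (h1 : r < 1) {k : ℕ} (hk : 1 ≤ k) : 1 ≤ facR r k := by
  obtain ⟨a, b, c, _⟩ := pow_facts h0 h1 hk
  rw [facR, c]
  have : 0 ≤ r ^ k / (1 - (r ^ k) ^ 2) := div_nonneg a.le (by nlinarith)
  linarith

lemma PR_pos {r : ℝ} (h0 : 0 < r) (h1 : r < 1) (m : ℕ) : 0 < PR r m :=
  Finset.prod_pos fun k _ => lt_of_lt_of_le one_pos (one_le_facR h0 h1 (by omega))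

lemma PR_succ (r : ℝ) (m : ℕ) : PR r (m + 1) = PR r m * facR r (m + 1) :=
  Finset.prod_range_succ _ _

lemma PP_succ (q : ℂ) (m : ℕ) : PP q (m + 1) = PP q m * fac q (m + 1) :=
  Finset.prod_range_succ _ _

lemma summable_PR_diff {r : ℝ} (h0 : 0 < r) (h1 : r < 1) :
    Summable (fun m => r ^ (m + 1) / (1 - (r ^ (m + 1)) ^ 2) * PR r m) := by
  have hnn : ∀ m, 0 ≤ r ^ (m + 1) / (1 - (r ^ (m + 1)) ^ 2) * PR r m := by
    intro m
    obtain ⟨a, b, c, _⟩ := pow_facts h0 h1 (k := m + 1) (by omega)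
    exact mul_nonneg (div_nonneg a.le (by nlinarith)) (PR_pos h0 h1 m).le
  refine summable_of_sum_range_le (c := Real.exp (r * (1 - r)⁻¹ * (1 - r)⁻¹)) hnn ?_
  intro n
  have hs : ∑ i ∈ Finset.range n, r ^ (i + 1) / (1 - (r ^ (i + 1)) ^ 2) * PR r i
      = PR r n - PR r 0 := by
    rw [← Finset.sum_range_sub]
    refine Finset.sum_congr rfl fun m _ => ?_
    rw [PR_succ, facR, show 2 * (m + 1) = (m + 1) * 2 by ring, pow_mul]; ring
  rw [hs]
  have hPR : PR r n ≤ Real.exp (r * (1 - r)⁻¹ * (1 - r)⁻¹) := by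
    calc PR r n ≤ ∏ k ∈ Finset.range n, Real.exp (r * (1 - r)⁻¹ * r ^ k) := by
          refine Finset.prod_le_prod (fun k _ => by
            have := one_le_facR h0 h1 (k := k + 1) (by omega); linarith) fun k _ => ?_
          obtain ⟨a, b, c, d⟩ := pow_facts h0 h1 (k := k + 1) (by omega)
          have h2 : r ^ (k + 1) / (1 - r ^ (2 * (k + 1))) ≤ r * (1 - r)⁻¹ * r ^ k := by
            rw [c, div_le_iff₀ (by nlinarith)]
            have h3 : (1 - r) ≤ 1 - (r ^ (k + 1)) ^ 2 := by nlinarith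
            calc r ^ (k + 1) = r * (1 - r)⁻¹ * r ^ k * (1 - r) := by
                  have : 1 - r ≠ 0 := by linarith
                  field_simp
                  ring
              _ ≤ _ := by
                  apply mul_le_mul_of_nonneg_left h3
                  have : 0 < 1 - r := by linarith
                  positivity
          have := Real.add_one_le_exp (r * (1 - r)⁻¹ * r ^ k)
          rw [facR]; linarith
      _ = Real.exp (∑ k ∈ Finset.range n, r * (1 - r)⁻¹ * r ^ k) := by rw [Real.exp_sum]
      _ ≤ _ := by
          rw [← Finset.mul_sum]
          apply Real.exp_le_exp.2
          have : 0 < 1 - r := by linarith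
          apply mul_le_mul_of_nonneg_left _ (by positivity)
          rw [← tsum_geometric_of_lt_one h0.le h1]
          exact (summable_geometric_of_lt_one h0.le h1).sum_le_tsum _ (fun i _ => by positivity)
  have : PR r 0 = 1 := by simp [PR]
  linarith

/-- The generating function with an added constant term. -/
noncomputable def FF (q : ℂ) : ℂ := 1 + ∑' n, (paE Odd n : ℂ) * q ^ n

/-- Real version. -/
noncomputable def FR (r : ℝ) : ℝ := 1 + ∑' n, (paE Odd n : ℝ) * r ^ n

lemma FF_ofReal (r : ℝ) : FF (r : ℂ) = (FR r : ℂ) := by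
  simp [FF, FR, Complex.ofReal_tsum]

lemma hg_odd : ∀ x : ℂ, ‖x‖ < 1 → HasSum (fun d : {d : ℕ // 0 < d ∧ Odd d} => x ^ d.1)
    (x / (1 - x ^ 2)) := by
  intro x hx
  have h := hasSum_odd hx
  let e : {d : ℕ // 0 < d ∧ Odd d} ≃ {d : ℕ // Odd d} :=
    Equiv.subtypeEquivRight (fun d => ⟨fun h => h.2, fun h => ⟨h.pos, h⟩⟩)
  rw [← e.hasSum_iff] at h
  exact h

lemma paOdd_gf {q : ℂ} (h0 : 0 < ‖q‖) (hq : ‖q‖ < 1) :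
    HasSum (fun n => (paE Odd n : ℂ) * q ^ n) (∑' m, q ^ (m + 1) / (1 - (q ^ (m + 1)) ^ 2) * PP q m) ∧
    Summable (fun n => (paE Odd n : ℝ) * ‖q‖ ^ n) := by
  refine hasSum_paE hq hg_odd ?_
  have := summable_PR_diff h0 hq
  rw [← Complex.summable_ofReal] at this
  convert! this using 1
  ext m
  rw [PP_ofReal]; push_cast; rfl

lemma fac_diff (q : ℂ) (m : ℕ) :
    q ^ (m + 1) / (1 - (q ^ (m + 1)) ^ 2) * PP q m = PP q (m + 1) - PP q m := by
  rw [PP_succ, fac, show 2 * (m + 1) = (m + 1) * 2 by ring, pow_mul]; ring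

lemma norm_PP_le_PR {q : ℂ} (h0 : 0 < ‖q‖) (hq : ‖q‖ < 1) (m : ℕ) : ‖PP q m‖ ≤ PR ‖q‖ m := by
  have h1 := hasSum_XM hq m
  have h2 := hasSum_XM (q := (‖q‖ : ℂ)) (by simpa using hq) m
  rw [PP_ofReal] at h2
  rw [← h1.1.tsum_eq]
  have h3 : HasSum (fun M : XM m => ‖q‖ ^ M.1.sum) (PR ‖q‖ m) := by
    rw [← Complex.hasSum_ofReal]
    simpa using h2.1
  rw [← h3.tsum_eq]
  have h4 : Summable (fun M : XM m => ‖q ^ M.1.sum‖) := by simpa [norm_pow] using h1.2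
  refine (norm_tsum_le_tsum_norm h4).trans (le_of_eq ?_)
  simp [norm_pow]

lemma tendsto_PP {q : ℂ} (h0 : 0 < ‖q‖) (hq : ‖q‖ < 1) :
    Tendsto (PP q) atTop (𝓝 (FF q)) := by
  obtain ⟨h, -⟩ := paOdd_gf h0 hq
  have hsum : Summable (fun m => q ^ (m + 1) / (1 - (q ^ (m + 1)) ^ 2) * PP q m) := by
    refine Summable.of_norm_bounded (summable_PR_diff h0 hq) fun m => ?_
    rw [norm_mul, norm_div, norm_pow]
    obtain ⟨a, b, c, _⟩ := pow_facts h0 hq (k := m + 1) (by omega)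
    have h1 : 1 - (‖q‖ ^ (m + 1)) ^ 2 ≤ ‖1 - (q ^ (m + 1)) ^ 2‖ := by
      have := norm_sub_norm_le (1 : ℂ) ((q ^ (m + 1)) ^ 2)
      simpa [norm_pow] using this
    have h2 : 0 < 1 - (‖q‖ ^ (m + 1)) ^ 2 := by nlinarith
    have h3 := norm_PP_le_PR h0 hq m
    have h4 : ‖q‖ ^ (m + 1) / ‖1 - (q ^ (m + 1)) ^ 2‖ ≤
        ‖q‖ ^ (m + 1) / (1 - (‖q‖ ^ (m + 1)) ^ 2) := div_le_div_of_nonneg_left a.le h2 h1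
    exact mul_le_mul h4 h3 (norm_nonneg _) (div_nonneg a.le h2.le)
  have hF : FF q = 1 + ∑' m, q ^ (m + 1) / (1 - (q ^ (m + 1)) ^ 2) * PP q m := by
    rw [FF, h.tsum_eq]
  have ht := hsum.hasSum.tendsto_sum_nat
  rw [hF]
  have := ht.const_add 1
  refine this.congr fun n => ?_
  simp_rw [fac_diff]
  rw [Finset.sum_range_sub]
  simp [PP]

lemma tendsto_PR {r : ℝ} (h0 : 0 < r) (h1 : r < 1) : Tendsto (PR r) atTop (𝓝 (FR r)) := by
  have := tendsto_PP (q := (r : ℂ)) (by simpa using h0.ne') (by simpa [abs_of_pos h0] using h1)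
  rw [FF_ofReal] at this
  have h2 := (Complex.continuous_re.tendsto _).comp this
  simpa [Function.comp_def, PP_ofReal] using h2

lemma summable_paOdd {r : ℝ} (h0 : 0 < r) (h1 : r < 1) :
    Summable (fun n => (paE Odd n : ℝ) * r ^ n) := by
  have := (paOdd_gf (q := (r : ℂ)) (by simpa using h0.ne') (by simpa [abs_of_pos h0] using h1)).2
  simpa [abs_of_pos h0] using this

lemma FR_ge_one {r : ℝ} (h0 : 0 < r) : 1 ≤ FR r := by
  have : 0 ≤ ∑' n, (paE Odd n : ℝ) * r ^ n := tsum_nonneg fun n => by positivity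
  rw [FR]; linarith

/-- The saving at `k`. -/
noncomputable def sv (r θ : ℝ) (k : ℕ) : ℝ := (r ^ k - r ^ (2 * k)) * (1 - Real.cos (k * θ))

lemma sv_nonneg {r θ : ℝ} (h0 : 0 < r) (h1 : r < 1) {k : ℕ} (hk : 1 ≤ k) : 0 ≤ sv r θ k := by
  obtain ⟨a, b, c, _⟩ := pow_facts h0 h1 hk
  rw [sv, c]
  exact mul_nonneg (by nlinarith) (by linarith [Real.cos_le_one (k * θ)])

lemma norm_one_add_polar {x α : ℝ} (hx : 0 ≤ x) (hx1 : x ≤ 1) :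
    ‖(1 : ℂ) + x * Complex.exp (α * Complex.I)‖ ≤ 1 + x - x * (1 - Real.cos α) / 2 := by
  have hc := Real.cos_le_one α
  have hc' := Real.neg_one_le_cos α
  have hnn : 0 ≤ 1 + x - x * (1 - Real.cos α) / 2 := by nlinarith
  have h1 : ‖(1 : ℂ) + x * Complex.exp (α * Complex.I)‖ ^ 2 = 1 + 2 * x * Real.cos α + x ^ 2 := by
    rw [← Complex.normSq_eq_norm_sq, Complex.normSq_apply]
    simp [Complex.exp_re, Complex.exp_im]
    have := Real.sin_sq_add_cos_sq α
    nlinarith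
  refine le_of_sq_le_sq ?_ hnn
  rw [h1]
  nlinarith [mul_nonneg hx (sub_nonneg.2 hc), mul_nonneg (mul_nonneg hx (sub_nonneg.2 hc)) (sub_nonneg.2 hx1), sq_nonneg (x * (1 - Real.cos α) / 2)]

lemma norm_fac_le {r θ : ℝ} (h0 : 0 < r) (h1 : r < 1) {k : ℕ} (hk : 1 ≤ k) :
    ‖fac (r * Complex.exp (θ * Complex.I)) k‖ ≤ facR r k * Real.exp (-(sv r θ k / 8)) := by
  obtain ⟨a, b, c, _⟩ := pow_facts h0 h1 hk
  have hsv := sv_nonneg (θ := θ) h0 h1 hk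
  set x := r ^ k with hx
  have hqk : ((r : ℂ) * Complex.exp (θ * Complex.I)) ^ k =
      (x : ℂ) * Complex.exp (((k * θ : ℝ) : ℂ) * Complex.I) := by
    rw [mul_pow, ← Complex.exp_nat_mul, hx]; push_cast; ring_nf
  set Q := ((r : ℂ) * Complex.exp (θ * Complex.I)) ^ k with hQ
  have hnQ : ‖Q‖ = x := by
    rw [hqk, norm_mul, Complex.norm_exp_ofReal_mul_I]; simp [abs_of_pos a]
  have hne : (1 : ℂ) - Q ^ 2 ≠ 0 := by
    intro h
    have : ‖Q ^ 2‖ = 1 := by rw [← sub_eq_zero.1 h]; simp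
    rw [norm_pow, hnQ] at this; nlinarith
  have h2 : fac (r * Complex.exp (θ * Complex.I)) k = (1 + Q) + Q ^ 3 / (1 - Q ^ 2) := by
    rw [fac, show 2 * k = k * 2 by ring, pow_mul, ← hQ]
    field_simp; ring
  have h3 : ‖Q ^ 3 / (1 - Q ^ 2)‖ ≤ x ^ 3 / (1 - x ^ 2) := by
    rw [norm_div, norm_pow, hnQ]
    have : 1 - x ^ 2 ≤ ‖1 - Q ^ 2‖ := by
      have := norm_sub_norm_le (1 : ℂ) (Q ^ 2)
      simpa [norm_pow, hnQ] using this
    gcongr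
    nlinarith
  have h4 : ‖1 + Q‖ ≤ 1 + x - x * (1 - Real.cos (k * θ)) / 2 := by
    rw [hqk]; exact norm_one_add_polar a.le b.le
  have hx2 : 0 < 1 - x ^ 2 := by nlinarith
  have h5 : facR r k = 1 + x + x ^ 3 / (1 - x ^ 2) := by
    rw [facR, c]; field_simp; ring
  have h6 : ‖fac (r * Complex.exp (θ * Complex.I)) k‖
      ≤ facR r k - x * (1 - Real.cos (k * θ)) / 2 := by
    rw [h2, h5]
    have := norm_add_le (1 + Q) (Q ^ 3 / (1 - Q ^ 2))
    linarith
  have hu : 0 ≤ 1 - Real.cos (k * θ) := by linarith [Real.cos_le_one (k * θ)]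
  have h7 : facR r k * (1 - x) ≤ 1 := by
    rw [facR, c]
    have : x / (1 - x ^ 2) * (1 - x) = x / (1 + x) := by
      rw [show 1 - x ^ 2 = (1 - x) * (1 + x) by ring]
      have : 1 - x ≠ 0 := by linarith
      have : 1 + x ≠ 0 := by linarith
      field_simp
    have h8 : x / (1 + x) ≤ x := div_le_self a.le (by linarith)
    nlinarith
  have hfp : 0 < facR r k := lt_of_lt_of_le one_pos (one_le_facR h0 h1 hk)
  have h9 : facR r k * (sv r θ k / 8) ≤ x * (1 - Real.cos (k * θ)) / 2 := by
    rw [sv, c]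
    have : facR r k * ((x - x ^ 2) * (1 - Real.cos (k * θ)) / 8)
      = (facR r k * (1 - x)) * (x * (1 - Real.cos (k * θ)) / 8) := by ring
    rw [this]
    have hxx : 0 ≤ x * (1 - Real.cos (k * θ)) := mul_nonneg a.le hu
    nlinarith
  have h10 := Real.add_one_le_exp (-(sv r θ k / 8))
  nlinarith

lemma exp_le_facR {r θ : ℝ} (h0 : 0 < r) (h1 : r < 1) {k : ℕ} (hk : 1 ≤ k) :
    Real.exp (r ^ k / 4 + sv r θ k / 8) ≤ facR r k := by
  obtain ⟨a, b, c, _⟩ := pow_facts h0 h1 hk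
  have hsv : sv r θ k ≤ 2 * r ^ k := by
    rw [sv, c]
    have := Real.cos_le_one (k * θ)
    have := Real.neg_one_le_cos (k * θ)
    have h3 : (r ^ k - (r ^ k) ^ 2) * (1 - Real.cos (k * θ)) ≤ (r ^ k) * 2 := by
      apply mul_le_mul <;> nlinarith
    linarith
  have h2 : Real.exp (r ^ k / 4 + sv r θ k / 8) ≤ Real.exp (r ^ k / 2) :=
    Real.exp_le_exp.2 (by linarith)
  refine h2.trans ?_
  have h3 : Real.exp (r ^ k / 2) ≤ 1 + r ^ k := by
    have h4 := Real.add_one_le_exp (-(r ^ k / 2))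
    rw [Real.exp_neg] at h4
    have h5 := Real.exp_pos (r ^ k / 2)
    have h6 : (-(r ^ k / 2) + 1) * Real.exp (r ^ k / 2) ≤ 1 := by
      calc _ ≤ (Real.exp (r ^ k / 2))⁻¹ * Real.exp (r ^ k / 2) := by gcongr
        _ = 1 := inv_mul_cancel₀ h5.ne'
    by_contra h
    push Not at h
    have : (-(r ^ k / 2) + 1) * (1 + r ^ k) < (-(r ^ k / 2) + 1) * Real.exp (r ^ k / 2) := by
      apply mul_lt_mul_of_pos_left h; linarith
    nlinarith
  refine h3.trans ?_
  rw [facR, c]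
  have : r ^ k ≤ r ^ k / (1 - (r ^ k) ^ 2) := by
    rw [le_div_iff₀ (by nlinarith)]; nlinarith [mul_pos a (mul_pos a a)]
  linarith

/-- Total saving. -/
noncomputable def SS (r θ : ℝ) : ℝ := ∑' k : ℕ, sv r θ (k + 1)

lemma norm_PP_le_aux {r θ : ℝ} (h0 : 0 < r) (h1 : r < 1) (m j : ℕ) :
    ‖PP (r * Complex.exp (θ * Complex.I)) m‖ ≤ PR r (m + j) *
      Real.exp (-(∑ k ∈ Finset.range (m + j), sv r θ (k + 1)) / 8) *
      Real.exp (-(∑ i ∈ Finset.range j, r ^ (m + 1 + i)) / 4) := by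
  induction j with
  | zero =>
    simp only [add_zero, Finset.range_zero, Finset.sum_empty, neg_zero, zero_div, Real.exp_zero,
      mul_one]
    rw [PP, norm_prod]
    have : PR r m * Real.exp (-(∑ k ∈ Finset.range m, sv r θ (k + 1)) / 8) =
        ∏ k ∈ Finset.range m, (facR r (k + 1) * Real.exp (-(sv r θ (k + 1) / 8))) := by
      rw [Finset.prod_mul_distrib, ← Real.exp_sum, PR]
      congr 2
      rw [Finset.sum_neg_distrib, ← Finset.sum_div]; ring
    rw [this]
    exact Finset.prod_le_prod (fun _ _ => norm_nonneg _) fun k _ => norm_fac_le h0 h1 (by omega)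
  | succ j ih =>
    refine ih.trans ?_
    rw [← add_assoc, PR_succ, Finset.sum_range_succ, Finset.sum_range_succ]
    have h := exp_le_facR (θ := θ) h0 h1 (k := m + j + 1) (by omega)
    have hp := PR_pos h0 h1 (m + j)
    have e1 : Real.exp (-(∑ k ∈ Finset.range (m + j), sv r θ (k + 1)) / 8) *
      Real.exp (-(∑ i ∈ Finset.range j, r ^ (m + 1 + i)) / 4) =
      Real.exp (r ^ (m + j + 1) / 4 + sv r θ (m + j + 1) / 8) *
      (Real.exp (-(∑ k ∈ Finset.range (m + j), sv r θ (k + 1) + sv r θ (m + j + 1)) / 8) *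
      Real.exp (-(∑ i ∈ Finset.range j, r ^ (m + 1 + i) + r ^ (m + 1 + j)) / 4)) := by
      rw [← Real.exp_add, ← Real.exp_add, ← Real.exp_add]
      congr 1
      rw [show m + 1 + j = m + j + 1 by ring]; ring
    rw [mul_assoc, e1]
    rw [mul_assoc, mul_assoc]
    gcongr

lemma summable_pow_cos {r θ : ℝ} (h0 : 0 < r) (h1 : r < 1) :
    HasSum (fun k : ℕ => r ^ (k + 1) * (1 - Real.cos ((k + 1 : ℕ) * θ)))
      (r * (1 + r) * (1 - Real.cos θ) / ((1 - r) * ((1 - r) ^ 2 + 2 * r * (1 - Real.cos θ)))) := by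
  have hg := (hasSum_geometric_of_lt_one h0.le h1).mul_left r
  set q : ℂ := r * Complex.exp (θ * Complex.I) with hq
  have hn : ‖q‖ < 1 := by
    rw [hq, norm_mul, Complex.norm_exp_ofReal_mul_I]; simpa [abs_of_pos h0] using h1
  have hc := Complex.hasSum_re ((hasSum_geometric_of_norm_lt_one hn).mul_left q)
  have h := hg.sub hc
  convert! h using 1
  · ext k
    have : q * q ^ k = ((r ^ (k + 1) : ℝ) : ℂ) * Complex.exp ((((k + 1 : ℕ) * θ : ℝ) : ℂ) * Complex.I) := by
      rw [← pow_succ', hq, mul_pow, ← Complex.exp_nat_mul]; push_cast; ring_nf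
    rw [this, Complex.re_ofReal_mul, Complex.exp_ofReal_mul_I_re]
    ring
  · have hc := Real.cos_le_one θ
    have hD : 0 < (1 - r) ^ 2 + 2 * r * (1 - Real.cos θ) := by
      have : 0 < (1 - r) ^ 2 := by apply pow_pos; linarith
      have : 0 ≤ 2 * r * (1 - Real.cos θ) := mul_nonneg (by linarith) (by linarith)
      linarith
    have hre : (q * (1 - q)⁻¹).re = (r * Real.cos θ - r ^ 2) / ((1 - r) ^ 2 + 2 * r * (1 - Real.cos θ)) := by
      have hqr : q.re = r * Real.cos θ := by
        rw [hq, Complex.re_ofReal_mul, Complex.exp_ofReal_mul_I_re]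
      have hqi : q.im = r * Real.sin θ := by
        rw [hq, Complex.im_ofReal_mul, Complex.exp_ofReal_mul_I_im]
      have hN : Complex.normSq (1 - q) = (1 - r) ^ 2 + 2 * r * (1 - Real.cos θ) := by
        rw [Complex.normSq_apply]
        simp [hqr, hqi]
        nlinarith [Real.sin_sq_add_cos_sq θ]
      rw [Complex.mul_re, Complex.inv_re, Complex.inv_im, hN]
      simp only [hqr, hqi, Complex.sub_re, Complex.sub_im, Complex.one_re, Complex.one_im]
      rw [← mul_div_assoc, ← mul_div_assoc, ← sub_div]
      congr 1
      nlinarith [Real.sin_sq_add_cos_sq θ]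
    rw [hre]
    have h1r : 1 - r ≠ 0 := by linarith
    have hD' := hD.ne'
    rw [← div_eq_mul_inv, div_sub_div _ _ h1r hD']
    congr 1
    ring

lemma summable_sv {r θ : ℝ} (h0 : 0 < r) (h1 : r < 1) : Summable (fun k : ℕ => sv r θ (k + 1)) ∧
    2 * r ^ 2 * (1 - Real.cos θ) / ((1 + r) * (1 - r) * ((1 - r) ^ 2 + 2 * r * (1 - Real.cos θ)))
      ≤ SS r θ := by
  have hA := summable_pow_cos (θ := θ) h0 h1
  have hB := summable_pow_cos (r := r ^ 2) (θ := θ) (by positivity) (by nlinarith)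
  have h := hA.sub hB
  have hf : (fun k : ℕ => r ^ (k + 1) * (1 - Real.cos ((k + 1 : ℕ) * θ)) -
      (r ^ 2) ^ (k + 1) * (1 - Real.cos ((k + 1 : ℕ) * θ))) = fun k : ℕ => sv r θ (k + 1) := by
    ext k
    rw [sv, ← pow_mul]; ring
  rw [hf] at h
  refine ⟨h.summable, ?_⟩
  rw [SS, h.tsum_eq]
  have hc : 0 ≤ 1 - Real.cos θ := by linarith [Real.cos_le_one θ]
  set u := 1 - Real.cos θ
  have hD : 0 < (1 - r) ^ 2 + 2 * r * u := by
    have : 0 < (1 - r) ^ 2 := by apply pow_pos; linarith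
    have : 0 ≤ 2 * r * u := mul_nonneg (by linarith) hc
    linarith
  have hD2 : 0 < (1 - r ^ 2) ^ 2 + 2 * r ^ 2 * u := by
    have : 0 < (1 - r ^ 2) ^ 2 := by apply pow_pos; nlinarith
    have : 0 ≤ 2 * r ^ 2 * u := mul_nonneg (by positivity) hc
    linarith
  have hr : 0 < 1 - r := by linarith
  have key : r ^ 2 * (1 + r ^ 2) * u / ((1 - r ^ 2) * ((1 - r ^ 2) ^ 2 + 2 * r ^ 2 * u)) ≤
      (1 + r ^ 2) * r * u / ((1 - r) * (1 + r) * ((1 - r) ^ 2 + 2 * r * u)) := by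
    rw [show (1 - r ^ 2) = (1 - r) * (1 + r) by ring] at hD2 ⊢
    rw [div_le_div_iff₀ (by positivity) (by positivity)]
    have h3 : r * ((1 - r) ^ 2 + 2 * r * u) ≤ ((1 - r) * (1 + r)) ^ 2 + 2 * r ^ 2 * u := by
      have : r * (1 - r) ^ 2 ≤ ((1 - r) * (1 + r)) ^ 2 := by
        rw [mul_pow, mul_comm]
        apply mul_le_mul_of_nonneg_left _ (by positivity)
        nlinarith
      nlinarith
    have h4 : 0 ≤ (1 + r ^ 2) * r * u * ((1 - r) * (1 + r)) := by positivity
    nlinarith [mul_le_mul_of_nonneg_left h3 h4]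
  refine le_trans (le_of_eq ?_) (sub_le_sub_left key _)
  have : 1 - r ≠ 0 := hr.ne'
  field_simp
  ring

lemma norm_PP_le {r θ : ℝ} (h0 : 0 < r) (h1 : r < 1) (m : ℕ) :
    ‖PP (r * Complex.exp (θ * Complex.I)) m‖ ≤ FR r * Real.exp (-(SS r θ) / 8) *
      Real.exp (-(r ^ (m + 1) / (1 - r)) / 4) := by
  have hs := (summable_sv (θ := θ) h0 h1).1.hasSum.tendsto_sum_nat
  have hadd : Tendsto (fun j => m + j) atTop atTop :=
    tendsto_atTop_mono (fun j => by simp only [id]; omega) tendsto_id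
  have hg : Tendsto (fun j => ∑ i ∈ Finset.range j, r ^ (m + 1 + i)) atTop
      (𝓝 (r ^ (m + 1) / (1 - r))) := by
    have := ((hasSum_geometric_of_lt_one h0.le h1).mul_left (r ^ (m + 1))).tendsto_sum_nat
    simpa [← pow_add, div_eq_mul_inv] using this
  have h2 := ((tendsto_PR h0 h1).comp hadd).mul
    ((Real.continuous_exp.tendsto _).comp ((hs.comp hadd).neg.div_const 8))
  have h3 := h2.mul ((Real.continuous_exp.tendsto _).comp (hg.neg.div_const 4))
  exact ge_of_tendsto' h3 fun j => norm_PP_le_aux h0 h1 m j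

lemma norm_FF_le {r θ : ℝ} (h0 : 0 < r) (h1 : r < 1) :
    ‖FF (r * Complex.exp (θ * Complex.I))‖ ≤ FR r * Real.exp (-(SS r θ) / 8) := by
  have hn : ‖(r * Complex.exp (θ * Complex.I) : ℂ)‖ = r := by
    rw [norm_mul, Complex.norm_exp_ofReal_mul_I]; simp [abs_of_pos h0]
  have := (tendsto_PP (q := r * Complex.exp (θ * Complex.I)) (by rw [hn]; exact h0)
    (by rw [hn]; exact h1)).norm
  refine le_of_tendsto' this fun m => (norm_PP_le h0 h1 m).trans ?_
  have hF : 0 < FR r := lt_of_lt_of_le one_pos (FR_ge_one h0)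
  apply mul_le_of_le_one_right (by positivity)
  apply Real.exp_le_one_iff.2
  have : 0 < 1 - r := by linarith
  have : 0 ≤ r ^ (m + 1) / (1 - r) := by positivity
  linarith

/-- Quantitative lower bound for the saving. -/
lemma SS_ge {t θ : ℝ} (ht : 0 < t) (ht1 : t ≤ 1) (hθ : |θ| ≤ Real.pi) :
    θ ^ 2 / (t * (t ^ 2 + θ ^ 2)) / 45 ≤ SS (Real.exp (-t)) θ := by
  set r := Real.exp (-t) with hr
  have h0 : 0 < r := Real.exp_pos _
  have h1 : r < 1 := by simpa [hr] using ht
  have hr1 : 1 - r ≤ t := by have := Real.add_one_le_exp (-t); linarith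
  have hr3 : 1 / 3 ≤ r := by
    have h2 : Real.exp (-1) ≤ r := Real.exp_le_exp.2 (by linarith)
    have h3 := Real.exp_one_lt_d9
    have h4 : Real.exp 1 * Real.exp (-1) = 1 := by rw [← Real.exp_add]; simp
    have h5 := Real.exp_pos (-1)
    nlinarith
  refine le_trans ?_ (summable_sv h0 h1).2
  have hu : θ ^ 2 / 5 ≤ 1 - Real.cos θ := by
    have h2 := Real.cos_le_one_sub_mul_cos_sq hθ
    have h3 : 1 / 5 ≤ 2 / Real.pi ^ 2 := by
      rw [div_le_div_iff₀ (by norm_num) (by positivity)]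
      nlinarith [Real.pi_lt_d2, Real.pi_pos]
    nlinarith [mul_le_mul_of_nonneg_right h3 (sq_nonneg θ)]
  set u := 1 - Real.cos θ
  have hu0 : 0 ≤ u := by have := sq_nonneg θ; linarith
  have hr0 : 0 < 1 - r := by linarith
  have e1 : θ ^ 2 / (t * (t ^ 2 + θ ^ 2)) / 45 ≤ 1 / 9 * (u / (t * (t ^ 2 + 2 * u))) := by
    rw [div_div, ← mul_div_assoc, div_le_div_iff₀ (by positivity) (by positivity)]
    have := sq_nonneg θ
    have h3 : θ ^ 2 * (t ^ 2 + 2 * u) ≤ 5 * u * (t ^ 2 + θ ^ 2) := by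
      nlinarith [mul_nonneg hu0 this, mul_le_mul_of_nonneg_right hu (sq_nonneg t)]
    nlinarith [mul_le_mul_of_nonneg_left h3 ht.le]
  refine e1.trans ?_
  have hr2 : 1 / 9 ≤ r ^ 2 := by nlinarith
  have e2 : (1 + r) * (1 - r) * ((1 - r) ^ 2 + 2 * r * u) ≤ 2 * (t * (t ^ 2 + 2 * u)) := by
    have a1 : (1 - r) ^ 2 + 2 * r * u ≤ t ^ 2 + 2 * u := by nlinarith
    have a2 : (1 - r) * ((1 - r) ^ 2 + 2 * r * u) ≤ t * (t ^ 2 + 2 * u) := by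
      apply mul_le_mul hr1 a1 (by positivity) ht.le
    have a3 : 0 ≤ (1 - r) * ((1 - r) ^ 2 + 2 * r * u) := by positivity
    nlinarith
  rcases hu0.eq_or_lt with hz | hz
  · rw [← hz]; simp
  calc 1 / 9 * (u / (t * (t ^ 2 + 2 * u))) ≤ r ^ 2 * (u / (t * (t ^ 2 + 2 * u))) := by gcongr
    _ = 2 * r ^ 2 * u / (2 * (t * (t ^ 2 + 2 * u))) := by field_simp
    _ ≤ _ := by gcongr

/-- Euler product (absolute value). -/
noncomputable def EE (r : ℝ) : ℝ := ‖∏' n : ℕ, (1 - (r : ℂ) ^ (n + 1))‖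

lemma norm_eta {y : ℝ} : ‖ModularForm.eta (y * Complex.I)‖ =
    Real.exp (-(Real.pi * y / 12)) * EE (Real.exp (-(2 * Real.pi * y))) := by
  rw [ModularForm.eta, norm_mul, EE]
  congr 1
  · rw [Function.Periodic.qParam, Complex.norm_exp]
    congr 1
    have : 2 * (Real.pi : ℂ) * Complex.I * (y * Complex.I) / ((24 : ℝ) : ℂ) =
        ((-(Real.pi * y / 12) : ℝ) : ℂ) := by
      push_cast
      linear_combination (Real.pi * y / 12 : ℂ) * Complex.I_sq
    rw [this, Complex.ofReal_re]
  · congr 2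
    ext n
    rw [ModularForm.eta_q_eq_pow]
    congr 2
    rw [Complex.ofReal_exp]
    congr 1
    push_cast
    linear_combination (2 * Real.pi * y : ℂ) * Complex.I_sq

lemma norm_csqrt (z : ℂ) : ‖Complex.sqrt z‖ = Real.sqrt ‖z‖ := by
  have : Complex.sqrt z ^ 2 = z := by
    rw [Complex.sqrt]; exact_mod_cast Complex.cpow_nat_inv_pow z two_ne_zero
  rw [← Real.sqrt_sq (norm_nonneg (Complex.sqrt z)), ← norm_pow, this]

lemma EE_transform {y : ℝ} (hy : 0 < y) :
    Real.exp (-(Real.pi * (1 / y) / 12)) * EE (Real.exp (-(2 * Real.pi * (1 / y)))) =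
    Real.sqrt y * (Real.exp (-(Real.pi * y / 12)) * EE (Real.exp (-(2 * Real.pi * y)))) := by
  have h := ModularForm.eta_comp_eq_csqrt_I_inv (x := y * Complex.I) (by
    simp [UpperHalfPlane.upperHalfPlaneSet, hy])
  have h2 := congrArg norm h
  simp only [Function.comp_apply, Pi.smul_apply, Pi.mul_apply, smul_eq_mul, norm_mul, norm_inv,
    norm_csqrt, norm_eta] at h2
  have h3 : (-1 : ℂ) / (y * Complex.I) = ((1 / y : ℝ) : ℂ) * Complex.I := by
    have : (y : ℂ) ≠ 0 := by exact_mod_cast hy.ne'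
    have := Complex.I_ne_zero
    push_cast
    field_simp
    simp
  rw [h3, norm_eta] at h2
  rw [h2]
  simp [abs_of_pos hy]

lemma tendsto_EE_zero : Tendsto EE (𝓝 0) (𝓝 1) := by
  have htprod : Tendsto (fun q : ℂ ↦ ∏' (n : ℕ), (1 - q ^ (n + 1))) (𝓝 0) (𝓝 1) := by
    have := tendsto_tprod_one_add_of_dominated_convergence (𝓕 := 𝓝 0) (g := 0)
      (f := fun (q : ℂ) (n : ℕ) ↦ -q ^ (n + 1)) (bound := fun n ↦ (1 / 2 : ℝ) ^ (n + 1))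
    simp only [Pi.zero_apply, norm_neg, norm_pow, add_zero, tprod_one] at this
    simp_rw [sub_eq_add_neg]
    refine this
      (by simpa only [pow_succ'] using (summable_geometric_of_abs_lt_one (by norm_num)).mul_left _)
      (fun k ↦ by simpa using ((continuous_pow (M := ℂ) (k + 1)).tendsto 0).neg) ?_
    filter_upwards [Metric.ball_mem_nhds (0 : ℂ) (by norm_num : (0 : ℝ) < 1 / 2)] with q hq k
    exact pow_le_pow_left₀ (norm_nonneg _) (mem_ball_zero_iff.mp hq).le _
  have h := (htprod.comp (Complex.continuous_ofReal.tendsto' 0 0 (by simp))).norm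
  have h2 : EE = fun x : ℝ => ‖∏' (n : ℕ), (1 - (x : ℂ) ^ (n + 1))‖ := rfl
  rw [h2]
  simpa [Function.comp_def] using h

/-- Asymptotics of the Euler product. -/
lemma EE_asymp : Tendsto (fun t : ℝ => EE (Real.exp (-(2 * t))) *
    (Real.sqrt (t / Real.pi) * Real.exp (Real.pi ^ 2 / (12 * t)))) (𝓝[>] 0) (𝓝 1) := by
  have hpi := Real.pi_pos
  have e : ∀ t : ℝ, 0 < t → EE (Real.exp (-(2 * t))) *
      (Real.sqrt (t / Real.pi) * Real.exp (Real.pi ^ 2 / (12 * t))) =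
      Real.exp (t / 12) * EE (Real.exp (-(2 * Real.pi ^ 2 * t⁻¹))) := by
    intro t ht
    have h := EE_transform (y := t / Real.pi) (by positivity)
    have a1 : 2 * Real.pi * (t / Real.pi) = 2 * t := by field_simp
    have a2 : Real.pi * (t / Real.pi) / 12 = t / 12 := by field_simp
    have a3 : Real.pi * (1 / (t / Real.pi)) / 12 = Real.pi ^ 2 / (12 * t) := by field_simp
    have a4 : 2 * Real.pi * (1 / (t / Real.pi)) = 2 * Real.pi ^ 2 * t⁻¹ := by field_simp
    rw [a1, a2, a3, a4] at h
    have p1 : Real.exp (t / 12) * Real.exp (-(t / 12)) = 1 := by rw [← Real.exp_add]; simp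
    have p2 : Real.exp (Real.pi ^ 2 / (12 * t)) * Real.exp (-(Real.pi ^ 2 / (12 * t))) = 1 := by
      rw [← Real.exp_add]; simp
    linear_combination (-(Real.exp (Real.pi ^ 2 / (12 * t)) * Real.exp (t / 12))) * h
      + (Real.exp (t / 12) * EE (Real.exp (-(2 * Real.pi ^ 2 * t⁻¹)))) * p2
      - (EE (Real.exp (-(2 * t))) * Real.sqrt (t / Real.pi) * Real.exp (Real.pi ^ 2 / (12 * t))) * p1
  have h1 : Tendsto (fun t : ℝ => Real.exp (t / 12)) (𝓝[>] 0) (𝓝 1) := by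
    have : Continuous (fun t : ℝ => Real.exp (t / 12)) := by fun_prop
    exact (this.tendsto' 0 1 (by simp)).mono_left nhdsWithin_le_nhds
  have h2 : Tendsto (fun t : ℝ => Real.exp (-(2 * Real.pi ^ 2 * t⁻¹))) (𝓝[>] 0) (𝓝 0) := by
    apply Real.tendsto_exp_neg_atTop_nhds_zero.comp
    exact tendsto_inv_nhdsGT_zero.const_mul_atTop (by positivity)
  have h3 := h1.mul (tendsto_EE_zero.comp h2)
  rw [mul_one] at h3
  refine h3.congr' ?_
  filter_upwards [self_mem_nhdsWithin] with t ht
  exact (e t ht).symm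

lemma tendsto_EE {r : ℝ} (h0 : 0 < r) (h1 : r < 1) :
    Tendsto (fun m => ∏ k ∈ Finset.range m, (1 - r ^ (k + 1))) atTop (𝓝 (EE r)) := by
  have h := (ModularForm.multipliable_one_sub_pow (q := (r : ℂ))
    (by simpa [abs_of_pos h0] using h1)).hasProd.tendsto_prod_nat.norm
  refine h.congr fun m => ?_
  have : ∏ k ∈ Finset.range m, (1 - (r : ℂ) ^ (k + 1)) =
      ((∏ k ∈ Finset.range m, (1 - r ^ (k + 1)) : ℝ) : ℂ) := by push_cast; rfl
  rw [this, Complex.norm_real, Real.norm_eq_abs, abs_of_nonneg]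
  refine Finset.prod_nonneg fun k _ => ?_
  have := pow_le_one₀ (n := k + 1) h0.le h1.le
  linarith


/-- The dilogarithm-type integrand. -/
noncomputable def kf (y x : ℝ) : ℝ := Real.log (1 + (Real.exp y - 1) * Real.exp (-x))

lemma kf_lower {y x S : ℝ} (hy : |y| ≤ S) (hx : 0 ≤ x) :
    Real.exp (-S) ≤ 1 + (Real.exp y - 1) * Real.exp (-x) := by
  have hu0 := Real.exp_pos (-x)
  have hu1 : Real.exp (-x) ≤ 1 := Real.exp_le_one_iff.2 (by linarith)
  have h1 : Real.exp (-S) ≤ Real.exp y := Real.exp_le_exp.2 (by linarith [neg_abs_le y])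
  have h2 : Real.exp (-S) ≤ 1 := Real.exp_le_one_iff.2 (by linarith [abs_nonneg y])
  nlinarith [mul_nonneg hu0.le (sub_nonneg.2 h1), mul_nonneg (sub_nonneg.2 hu1) (sub_nonneg.2 h2)]

lemma kf_pos {y x : ℝ} (hx : 0 ≤ x) : 0 < 1 + (Real.exp y - 1) * Real.exp (-x) :=
  lt_of_lt_of_le (Real.exp_pos _) (kf_lower le_rfl hx)

lemma kf_deriv_y {y x : ℝ} (hx : 0 ≤ x) : HasDerivAt (fun y => kf y x)
    (Real.exp y * Real.exp (-x) / (1 + (Real.exp y - 1) * Real.exp (-x))) y := by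
  have := kf_pos (y := y) hx
  have h := (((Real.hasDerivAt_exp y).sub_const 1).mul_const (Real.exp (-x))).const_add 1
  exact h.log this.ne'

lemma kf_deriv_x {y x : ℝ} (hx : 0 ≤ x) : HasDerivAt (fun x => kf y x)
    (-((Real.exp y - 1) * Real.exp (-x) / (1 + (Real.exp y - 1) * Real.exp (-x)))) x := by
  have := kf_pos (y := y) hx
  have h := (((hasDerivAt_neg x).exp).const_mul (Real.exp y - 1)).const_add 1
  convert! h.log this.ne' using 1
  ring

lemma kf_cont (y : ℝ) : ContinuousOn (kf y) (Set.Ici 0) := fun _ hx =>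
  (kf_deriv_x hx).continuousAt.continuousWithinAt

lemma exp_neg_integrable : MeasureTheory.IntegrableOn (fun x : ℝ => Real.exp (-x)) (Set.Ioi 0) := by
  simpa using integrableOn_exp_neg_Ioi 0

lemma kf_bound {y x : ℝ} (hx : 0 ≤ x) :
    |kf y x| ≤ |Real.exp y - 1| * Real.exp (|y|) * Real.exp (-x) := by
  have hp := kf_pos (y := y) hx
  have hl := kf_lower (y := y) le_rfl hx
  have h1 := Real.log_le_sub_one_of_pos hp
  have h2 := Real.one_sub_inv_le_log_of_pos hp
  have hu0 := Real.exp_pos (-x)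
  set a := Real.exp y - 1
  have hE : 1 ≤ Real.exp |y| := Real.one_le_exp (abs_nonneg y)
  have hinv : (1 + a * Real.exp (-x))⁻¹ ≤ Real.exp |y| := by
    rw [inv_le_comm₀ hp (Real.exp_pos _), ← Real.exp_neg]; exact hl
  have hinv0 : 0 < (1 + a * Real.exp (-x))⁻¹ := inv_pos.2 hp
  have h3 : 1 - (1 + a * Real.exp (-x))⁻¹ = a * Real.exp (-x) * (1 + a * Real.exp (-x))⁻¹ := by
    field_simp; ring
  have hau : |a * Real.exp (-x)| = |a| * Real.exp (-x) := by rw [abs_mul, abs_of_pos hu0]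
  rw [kf, abs_le]
  constructor
  · refine le_trans ?_ h2
    rw [h3]
    have h4 : |a * Real.exp (-x) * (1 + a * Real.exp (-x))⁻¹| ≤ |a| * Real.exp |y| * Real.exp (-x) := by
      rw [abs_mul, hau, abs_of_pos hinv0]
      have := mul_le_mul_of_nonneg_left hinv (mul_nonneg (abs_nonneg a) hu0.le)
      linarith
    exact (abs_le.1 h4).1
  · refine h1.trans ?_
    have h5 : a * Real.exp (-x) ≤ |a| * Real.exp (-x) := by
      rw [← hau]; exact le_abs_self _
    have h6 := mul_le_mul_of_nonneg_left hE (mul_nonneg (abs_nonneg a) hu0.le)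
    linarith

lemma kf_int (y : ℝ) : MeasureTheory.IntegrableOn (kf y) (Set.Ioi 0) := by
  refine MeasureTheory.Integrable.mono' (exp_neg_integrable.const_mul (|Real.exp y - 1| * Real.exp (|y|)))
    (((kf_cont y).mono Set.Ioi_subset_Ici_self).aestronglyMeasurable measurableSet_Ioi) ?_
  refine (MeasureTheory.ae_restrict_iff' measurableSet_Ioi).2 (Filter.Eventually.of_forall fun x hx => ?_)
  exact kf_bound (le_of_lt hx)

/-- The dilogarithm-type integral. -/
noncomputable def KK (y : ℝ) : ℝ := ∫ x in Set.Ioi 0, kf y x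

/-- Derivative integrand. -/
noncomputable def kf' (y x : ℝ) : ℝ :=
  Real.exp y * Real.exp (-x) / (1 + (Real.exp y - 1) * Real.exp (-x))

lemma kf'_cont (y : ℝ) : ContinuousOn (kf' y) (Set.Ici 0) := by
  unfold kf'
  refine ContinuousOn.div (by fun_prop) (by fun_prop) fun x hx => (kf_pos hx).ne'

lemma kf'_bound {y x S : ℝ} (hy : |y| ≤ S) (hx : 0 ≤ x) :
    |kf' y x| ≤ Real.exp S * Real.exp S * Real.exp (-x) := by
  have hp := kf_pos (y := y) hx
  have hl := kf_lower (y := y) hy hx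
  rw [kf', abs_of_pos (by positivity), div_le_iff₀ hp]
  have h1 : Real.exp y ≤ Real.exp S := Real.exp_le_exp.2 (by linarith [le_abs_self y])
  have h2 : Real.exp S * Real.exp (-S) = 1 := by rw [← Real.exp_add]; simp
  calc Real.exp y * Real.exp (-x) ≤ Real.exp S * Real.exp (-x) := by gcongr
    _ = Real.exp S * Real.exp S * Real.exp (-x) * Real.exp (-S) := by
        linear_combination (-(Real.exp S * Real.exp (-x))) * h2
    _ ≤ _ := by gcongr

lemma KK_deriv (y : ℝ) : HasDerivAt KK (∫ x in Set.Ioi 0, kf' y x) y := by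
  have h := hasDerivAt_integral_of_dominated_loc_of_deriv_le (𝕜 := ℝ)
    (μ := MeasureTheory.volume.restrict (Set.Ioi (0 : ℝ))) (F := kf) (F' := kf') (x₀ := y)
    (s := Metric.ball y 1) (bound := fun x => Real.exp (|y| + 1) * Real.exp (|y| + 1) * Real.exp (-x))
    (Metric.ball_mem_nhds y one_pos)
    (Filter.Eventually.of_forall fun z =>
      ((kf_cont z).mono Set.Ioi_subset_Ici_self).aestronglyMeasurable measurableSet_Ioi)
    (kf_int y)
    (((kf'_cont y).mono Set.Ioi_subset_Ici_self).aestronglyMeasurable measurableSet_Ioi)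
    ((MeasureTheory.ae_restrict_iff' measurableSet_Ioi).2 (Filter.Eventually.of_forall
      fun x hx z hz => kf'_bound (by
        have h1 : |z - y| < 1 := by simpa [Real.dist_eq] using hz
        have h2 := abs_sub_abs_le_abs_sub z y
        linarith) (le_of_lt hx)))
    (exp_neg_integrable.const_mul _)
    ((MeasureTheory.ae_restrict_iff' measurableSet_Ioi).2 (Filter.Eventually.of_forall
      fun x hx z hz => kf_deriv_y (le_of_lt hx)))
  exact h.2

lemma kf'_int (y : ℝ) : MeasureTheory.IntegrableOn (kf' y) (Set.Ioi 0) := by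
  refine MeasureTheory.Integrable.mono' (exp_neg_integrable.const_mul (Real.exp |y| * Real.exp |y|))
    (((kf'_cont y).mono Set.Ioi_subset_Ici_self).aestronglyMeasurable measurableSet_Ioi) ?_
  refine (MeasureTheory.ae_restrict_iff' measurableSet_Ioi).2 (Filter.Eventually.of_forall fun x hx => ?_)
  exact kf'_bound le_rfl (le_of_lt hx)

lemma kf'_integral {y : ℝ} (hy : y ≠ 0) :
    ∫ x in Set.Ioi 0, kf' y x = y * Real.exp y / (Real.exp y - 1) := by
  have ha : Real.exp y - 1 ≠ 0 := by
    intro h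
    apply hy
    have : Real.exp y = 1 := by linarith
    simpa using this
  have h := MeasureTheory.integral_Ioi_of_hasDerivAt_of_tendsto'
    (f := fun x => -(Real.exp y / (Real.exp y - 1)) * kf y x) (f' := kf' y) (a := 0) (m := 0)
    (fun x hx => by
      convert! (kf_deriv_x (y := y) hx).const_mul (-(Real.exp y / (Real.exp y - 1))) using 1
      rw [kf']
      have := (kf_pos (y := y) hx).ne'
      field_simp) (kf'_int y) (by
      have h1 : Tendsto (fun x : ℝ => 1 + (Real.exp y - 1) * Real.exp (-x)) atTop (𝓝 (1 + (Real.exp y - 1) * 0)) :=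
        (Real.tendsto_exp_neg_atTop_nhds_zero.const_mul _).const_add 1
      have h2 := (h1.log (by simp)).const_mul (-(Real.exp y / (Real.exp y - 1)))
      simpa [kf] using h2)
  rw [h]
  have : kf y 0 = y := by simp [kf]
  rw [this]
  ring

lemma KK_sym (s : ℝ) : KK (2 * s) + KK (-(2 * s)) = 2 * s ^ 2 := by
  have hd : ∀ s : ℝ, HasDerivAt (fun s => KK (2 * s) + KK (-(2 * s)) - 2 * s ^ 2) 0 s := by
    intro s
    have h1 : HasDerivAt (fun s : ℝ => 2 * s) 2 s := by simpa using (hasDerivAt_id s).const_mul 2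
    have h2 := (KK_deriv (2 * s)).comp s h1
    have h3 := (KK_deriv (-(2 * s))).comp s h1.neg
    have h4 := (h2.add h3).sub ((hasDerivAt_pow 2 s).const_mul 2)
    convert! h4 using 1
    rcases eq_or_ne s 0 with rfl | hs
    · simp
    · rw [kf'_integral (by simpa using hs), kf'_integral (by simpa using hs)]
      have ha : Real.exp (2 * s) - 1 ≠ 0 := by
        intro h
        have : Real.exp (2 * s) = 1 := by linarith
        simp [hs] at this
      have hb : Real.exp (-(2 * s)) - 1 ≠ 0 := by
        intro h
        have : Real.exp (-(2 * s)) = 1 := by linarith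
        simp [hs] at this
      have he : Real.exp (2 * s) * Real.exp (-(2 * s)) = 1 := by rw [← Real.exp_add]; simp
      have key : Real.exp (2 * s) / (Real.exp (2 * s) - 1) +
        Real.exp (-(2 * s)) / (Real.exp (-(2 * s)) - 1) = 1 := by
        rw [div_add_div _ _ ha hb, div_eq_one_iff_eq (mul_ne_zero ha hb)]
        linear_combination he
      push_cast
      linear_combination (-4 * s) * key
  have hc := is_const_of_deriv_eq_zero (f := fun s => KK (2 * s) + KK (-(2 * s)) - 2 * s ^ 2)
    (fun s => (hd s).differentiableAt) (fun s => (hd s).deriv) s 0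
  have h0 : KK 0 = 0 := by simp [KK, kf]
  simp [h0] at hc
  linarith

/-- The logarithm of the numerator factor. -/
noncomputable def Lf (x : ℝ) : ℝ := Real.log (1 + Real.exp (-x) - Real.exp (-x) ^ 2)

lemma Lf_eq {x : ℝ} (hx : 0 ≤ x) :
    Lf x = kf (2 * Real.log ((1 + Real.sqrt 5) / 2)) x + kf (-(2 * Real.log ((1 + Real.sqrt 5) / 2))) x := by
  have h5 : Real.sqrt 5 ^ 2 = 5 := Real.sq_sqrt (by norm_num)
  have hphi : 0 < (1 + Real.sqrt 5) / 2 := by positivity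
  set φ := (1 + Real.sqrt 5) / 2 with hφ
  have hq : φ ^ 2 = φ + 1 := by rw [hφ]; nlinarith
  have e1 : Real.exp (2 * Real.log φ) = φ ^ 2 := by
    rw [two_mul, Real.exp_add, Real.exp_log hphi]; ring
  have e2 : Real.exp (-(2 * Real.log φ)) = 2 - φ := by
    rw [Real.exp_neg, e1]
    apply inv_eq_of_mul_eq_one_right
    nlinarith
  have p1 := kf_pos (y := 2 * Real.log φ) hx
  have p2 := kf_pos (y := -(2 * Real.log φ)) hx
  rw [Lf, kf, kf, ← Real.log_mul p1.ne' p2.ne', e1, e2]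
  congr 1
  linear_combination (-Real.exp (-x) + φ * Real.exp (-x) ^ 2) * hq

lemma Lf_int : MeasureTheory.IntegrableOn Lf (Set.Ioi 0) ∧
    ∫ x in Set.Ioi 0, Lf x = 2 * Real.log ((1 + Real.sqrt 5) / 2) ^ 2 := by
  have e : Set.EqOn Lf (fun x => kf (2 * Real.log ((1 + Real.sqrt 5) / 2)) x +
    kf (-(2 * Real.log ((1 + Real.sqrt 5) / 2))) x) (Set.Ioi 0) := fun x hx => Lf_eq (le_of_lt hx)
  constructor
  · exact ((kf_int _).add (kf_int _)).congr_fun e.symm measurableSet_Ioi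
  · rw [MeasureTheory.setIntegral_congr_fun measurableSet_Ioi e,
      MeasureTheory.integral_add (kf_int _) (kf_int _)]
    exact KK_sym _


/-- Derivative of `Lf`. -/
noncomputable def Lf' (x : ℝ) : ℝ :=
  (2 * Real.exp (-x) ^ 2 - Real.exp (-x)) / (1 + Real.exp (-x) - Real.exp (-x) ^ 2)

lemma exp_neg_facts {x : ℝ} (hx : 0 ≤ x) : 0 < Real.exp (-x) ∧ Real.exp (-x) ≤ 1 ∧
    1 ≤ 1 + Real.exp (-x) - Real.exp (-x) ^ 2 := by
  have h0 := Real.exp_pos (-x)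
  have h1 : Real.exp (-x) ≤ 1 := Real.exp_le_one_iff.2 (by linarith)
  exact ⟨h0, h1, by nlinarith⟩

lemma Lf_deriv {x : ℝ} (hx : 0 ≤ x) : HasDerivAt Lf (Lf' x) x := by
  obtain ⟨a, b, c⟩ := exp_neg_facts hx
  have h1 : HasDerivAt (fun x => Real.exp (-x)) (-Real.exp (-x)) x := by
    simpa using (hasDerivAt_neg x).exp
  have h := ((h1.const_add 1).sub (h1.pow 2)).log (by simp only [Pi.sub_apply, Pi.pow_apply]; linarith)
  convert! h using 1
  rw [Lf']
  simp
  ring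

lemma Lf_nonneg {x : ℝ} (hx : 0 ≤ x) : 0 ≤ Lf x := Real.log_nonneg (exp_neg_facts hx).2.2

lemma Lf_le {x : ℝ} (hx : 0 ≤ x) : Lf x ≤ Real.exp (-x) := by
  obtain ⟨a, b, c⟩ := exp_neg_facts hx
  refine (Real.log_le_sub_one_of_pos (by linarith)).trans ?_
  nlinarith

lemma exp_neg_lip {a x y : ℝ} (hx : a ≤ x) (hy : a ≤ y) :
    |Real.exp (-x) - Real.exp (-y)| ≤ Real.exp (-a) * |x - y| := by
  have h := Convex.norm_image_sub_le_of_norm_hasDerivWithin_le (f := fun x => Real.exp (-x))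
    (f' := fun x => -Real.exp (-x)) (s := Set.Ici a) (C := Real.exp (-a)) (x := y) (y := x)
    (fun z _ => by
      have : HasDerivAt (fun x => Real.exp (-x)) (-Real.exp (-z)) z := by
        simpa using (hasDerivAt_neg z).exp
      exact this.hasDerivWithinAt)
    (fun z hz => by
      rw [norm_neg, Real.norm_eq_abs, abs_of_pos (Real.exp_pos _)]
      exact Real.exp_le_exp.2 (neg_le_neg hz)) (convex_Ici a) hy hx
  simpa [Real.norm_eq_abs] using h

lemma Lf'_lip {a x y : ℝ} (ha : 0 ≤ a) (hx : a ≤ x) (hy : a ≤ y) :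
    |Lf' x - Lf' y| ≤ 4 * Real.exp (-a) * |x - y| := by
  obtain ⟨a1, b1, c1⟩ := exp_neg_facts (ha.trans hx)
  obtain ⟨a2, b2, c2⟩ := exp_neg_facts (ha.trans hy)
  have h := exp_neg_lip hx hy
  rw [Lf', Lf']
  set u := Real.exp (-x)
  set v := Real.exp (-y)
  rw [div_sub_div _ _ (by linarith) (by linarith)]
  have e : (2 * u ^ 2 - u) * (1 + v - v ^ 2) - (1 + u - u ^ 2) * (2 * v ^ 2 - v) =
    (u - v) * (2 * (u + v) - 1 + u * v) := by ring
  rw [e, abs_div, abs_mul]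
  have hD : 1 ≤ (1 + u - u ^ 2) * (1 + v - v ^ 2) := one_le_mul_of_one_le_of_one_le c1 c2
  have hN : |2 * (u + v) - 1 + u * v| ≤ 4 := by
    rw [abs_le]; constructor <;> nlinarith
  calc |u - v| * |2 * (u + v) - 1 + u * v| / |(1 + u - u ^ 2) * (1 + v - v ^ 2)|
      ≤ |u - v| * |2 * (u + v) - 1 + u * v| := by
        apply div_le_self (by positivity)
        rw [abs_of_pos (by linarith)]; exact hD
    _ ≤ (Real.exp (-a) * |x - y|) * 4 := by gcongr
    _ = _ := by ring

lemma Lf_contOn : ContinuousOn Lf (Set.Ici 0) := fun _ hx =>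
  (Lf_deriv hx).continuousAt.continuousWithinAt


lemma Lf_taylor {a x : ℝ} (ha : 0 ≤ a) (hx : a ≤ x) :
    |Lf x - Lf a - (x - a) * Lf' x| ≤ 4 * Real.exp (-a) * (x - a) * (x - a) := by
  have h := Convex.norm_image_sub_le_of_norm_hasDerivWithin_le (f := fun z => Lf z - z * Lf' x)
    (f' := fun z => Lf' z - 1 * Lf' x) (s := Set.Icc a x) (C := 4 * Real.exp (-a) * (x - a)) (x := a) (y := x)
    (fun z hz => ((Lf_deriv (ha.trans hz.1)).sub ((hasDerivAt_id z).mul_const (Lf' x))).hasDerivWithinAt)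
    (fun z hz => by
      rw [one_mul, Real.norm_eq_abs]
      refine (Lf'_lip ha hz.1 hx).trans ?_
      have : |z - x| ≤ x - a := by rw [abs_le]; constructor <;> linarith [hz.1, hz.2]
      gcongr) (convex_Icc a x) (Set.left_mem_Icc.2 hx) (Set.right_mem_Icc.2 hx)
  rw [Real.norm_eq_abs, Real.norm_eq_abs, abs_of_nonneg (sub_nonneg.2 hx)] at h
  convert! h using 2
  ring

lemma Lf_trap {a t : ℝ} (ha : 0 ≤ a) (ht : 0 ≤ t) :
    |(∫ x in a..(a + t), Lf x) - t * ((Lf a + Lf (a + t)) / 2)| ≤ 2 * Real.exp (-a) * t ^ 3 := by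
  have hd : ∀ x ∈ Set.Icc a (a + t), HasDerivWithinAt
      (fun x => (∫ z in a..x, Lf z) - (x - a) * ((Lf a + Lf x) / 2))
      (Lf x - (1 * ((Lf a + Lf x) / 2) + (x - a) * (Lf' x / 2))) (Set.Icc a (a + t)) x := by
    intro x hx
    have hx0 : 0 ≤ x := ha.trans hx.1
    have h1 : HasDerivWithinAt (fun x => ∫ z in a..x, Lf z) (Lf x) (Set.Icc a (a + t)) x := by
      have : Fact (x ∈ Set.Icc a (a + t)) := ⟨hx⟩
      refine intervalIntegral.integral_hasDerivWithinAt_right ?_ (t := Set.Icc a (a + t)) ?_ ?_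
      · apply ContinuousOn.intervalIntegrable
        apply Lf_contOn.mono
        rw [Set.uIcc_of_le hx.1]
        exact fun z hz => ha.trans hz.1
      · exact (Lf_contOn.mono (fun z hz => ha.trans hz.1)).stronglyMeasurableAtFilter_nhdsWithin
          measurableSet_Icc x
      · exact (Lf_contOn.mono (fun z hz => ha.trans hz.1)) x hx
    have h2 := (((hasDerivAt_id x).sub_const a).mul (((Lf_deriv hx0).const_add (Lf a)).div_const 2))
    exact h1.sub h2.hasDerivWithinAt
  have h := Convex.norm_image_sub_le_of_norm_hasDerivWithin_le (s := Set.Icc a (a + t))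
    (C := 2 * Real.exp (-a) * t ^ 2) (x := a) (y := a + t) hd
    (fun x hx => by
      have := Lf_taylor ha hx.1
      rw [Real.norm_eq_abs, show Lf x - (1 * ((Lf a + Lf x) / 2) + (x - a) * (Lf' x / 2)) =
        (Lf x - Lf a - (x - a) * Lf' x) / 2 by ring, abs_div, abs_two]
      have h3 : (x - a) * (x - a) ≤ t * t := by
        apply mul_le_mul <;> linarith [hx.1, hx.2]
      have := mul_le_mul_of_nonneg_left h3 (Real.exp_pos (-a)).le
      linarith)
    (convex_Icc _ _) (Set.left_mem_Icc.2 (by linarith)) (Set.right_mem_Icc.2 (by linarith))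
  simp [abs_of_nonneg ht] at h
  calc _ ≤ _ := h
    _ = _ := by ring

lemma Lf_summable {t : ℝ} (ht : 0 < t) : Summable (fun k : ℕ => Lf ((k + 1 : ℕ) * t)) := by
  refine Summable.of_nonneg_of_le (fun k => Lf_nonneg (by positivity))
    (fun k => Lf_le (by positivity)) ?_
  have h := (summable_geometric_of_lt_one (Real.exp_pos (-t)).le (by simpa using ht)).mul_left (Real.exp (-t))
  refine h.congr fun k => ?_
  rw [← Real.exp_nat_mul, ← Real.exp_add]
  congr 1; push_cast; ring

lemma one_sub_exp_ge {t : ℝ} (ht : 0 < t) (ht1 : t ≤ 1) : t / 2 ≤ 1 - Real.exp (-t) := by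
  have h1 := Real.add_one_le_exp t
  have h2 : Real.exp (-t) * Real.exp t = 1 := by rw [← Real.exp_add]; simp
  have h3 := Real.exp_pos (-t)
  have h4 : Real.exp (-t) * (t + 1) ≤ 1 := by nlinarith
  by_contra hc
  push Not at hc
  nlinarith

lemma Lf_sum {t : ℝ} (ht : 0 < t) (ht1 : t ≤ 1) :
    |2 * Real.log ((1 + Real.sqrt 5) / 2) ^ 2 / t - ∑' k : ℕ, Lf ((k + 1 : ℕ) * t)| ≤ 4 * t := by
  have hfin : ∀ N : ℕ, |(∫ x in (0:ℝ)..(N * t), Lf x) -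
      t * (∑ k ∈ Finset.range N, Lf ((k + 1 : ℕ) * t) - Lf (N * t) / 2)| ≤
      2 * t ^ 3 * ∑ k ∈ Finset.range N, Real.exp (-t) ^ k := by
    intro N
    induction N with
    | zero => simp [Lf]
    | succ N ih =>
      have h := Lf_trap (a := N * t) (t := t) (by positivity) ht.le
      have hi : ∀ a b : ℝ, 0 ≤ a → a ≤ b → IntervalIntegrable Lf MeasureTheory.volume a b := by
        intro a b ha hab
        apply ContinuousOn.intervalIntegrable
        apply Lf_contOn.mono
        rw [Set.uIcc_of_le hab]
        exact fun z hz => ha.trans hz.1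
      have e1 : (N : ℝ) * t + t = ((N + 1 : ℕ) : ℝ) * t := by push_cast; ring
      rw [e1] at h
      rw [← intervalIntegral.integral_add_adjacent_intervals (b := N * t)
        (hi _ _ le_rfl (by positivity)) (hi _ _ (by positivity) (by push_cast; nlinarith)),
        Finset.sum_range_succ, Finset.sum_range_succ]
      have e2 : Real.exp (-(N * t)) = Real.exp (-t) ^ N := by
        rw [← Real.exp_nat_mul]; congr 1; ring
      rw [e2] at h
      have h3 := abs_add_le ((∫ x in (0:ℝ)..(N * t), Lf x) -
        t * (∑ k ∈ Finset.range N, Lf ((k + 1 : ℕ) * t) - Lf (N * t) / 2))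
        ((∫ x in (N * t)..((N + 1 : ℕ) * t), Lf x) - t * ((Lf (N * t) + Lf ((N + 1 : ℕ) * t)) / 2))
      refine le_trans (le_of_eq ?_) (h3.trans ((add_le_add ih h).trans (le_of_eq ?_)))
      · congr 1; ring
      · ring
  have hg : ∀ N : ℕ, 2 * t ^ 3 * ∑ k ∈ Finset.range N, Real.exp (-t) ^ k ≤ 4 * t ^ 2 := by
    intro N
    have h1 : Real.exp (-t) < 1 := by simpa using ht
    have h2 : ∑ k ∈ Finset.range N, Real.exp (-t) ^ k ≤ (1 - Real.exp (-t))⁻¹ := by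
      rw [← tsum_geometric_of_lt_one (Real.exp_pos _).le h1]
      exact (summable_geometric_of_lt_one (Real.exp_pos _).le h1).sum_le_tsum _ (fun i _ => by positivity)
    have h3 : (1 - Real.exp (-t))⁻¹ ≤ (t / 2)⁻¹ :=
      inv_anti₀ (by positivity) (one_sub_exp_ge ht ht1)
    calc _ ≤ 2 * t ^ 3 * (t / 2)⁻¹ := by gcongr; exact h2.trans h3
      _ = _ := by field_simp; ring
  have hNt : Tendsto (fun N : ℕ => (N : ℝ) * t) atTop atTop :=
    tendsto_natCast_atTop_atTop.atTop_mul_const ht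
  have l1 := MeasureTheory.intervalIntegral_tendsto_integral_Ioi 0 Lf_int.1 hNt
  have l2 := (Lf_summable ht).hasSum.tendsto_sum_nat
  have l3 : Tendsto (fun N : ℕ => Lf (N * t)) atTop (𝓝 0) := by
    refine squeeze_zero (fun N => Lf_nonneg (by positivity)) (fun N => Lf_le (by positivity)) ?_
    exact Real.tendsto_exp_neg_atTop_nhds_zero.comp hNt
  have l4 := (l1.sub ((l2.sub (l3.div_const 2)).const_mul t)).abs
  have h5 := le_of_tendsto' l4 fun N => (hfin N).trans (hg N)
  rw [Lf_int.2] at h5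
  have e : 2 * Real.log ((1 + Real.sqrt 5) / 2) ^ 2 / t - ∑' k : ℕ, Lf ((k + 1 : ℕ) * t) =
    (2 * Real.log ((1 + Real.sqrt 5) / 2) ^ 2 - t * (∑' k : ℕ, Lf ((k + 1 : ℕ) * t) - 0 / 2)) / t := by
    field_simp; ring
  rw [e, abs_div, abs_of_pos ht, div_le_iff₀ ht]
  linarith

lemma FR_mul_EE {t : ℝ} (ht : 0 < t) :
    FR (Real.exp (-t)) * EE (Real.exp (-(2 * t))) = Real.exp (∑' k : ℕ, Lf ((k + 1 : ℕ) * t)) := by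
  have h0 := Real.exp_pos (-t)
  have h1 : Real.exp (-t) < 1 := by simpa using ht
  have l1 := (tendsto_PR h0 h1).mul (tendsto_EE (Real.exp_pos (-(2 * t))) (by simpa using ht))
  have l2 := (Real.continuous_exp.tendsto _).comp (Lf_summable ht).hasSum.tendsto_sum_nat
  refine tendsto_nhds_unique l1 (l2.congr fun m => ?_)
  rw [Function.comp_apply, Real.exp_sum, PR, ← Finset.prod_mul_distrib]
  refine Finset.prod_congr rfl fun k _ => ?_
  have hx : (0 : ℝ) ≤ (k + 1 : ℕ) * t := by positivity
  obtain ⟨a, b, c⟩ := exp_neg_facts hx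
  have e1 : Real.exp (-t) ^ (k + 1) = Real.exp (-((k + 1 : ℕ) * t)) := by
    rw [← Real.exp_nat_mul]; congr 1; ring
  have e2 : Real.exp (-(2 * t)) ^ (k + 1) = Real.exp (-((k + 1 : ℕ) * t)) ^ 2 := by
    rw [← Real.exp_nat_mul, ← Real.exp_nat_mul]; congr 1; push_cast; ring
  rw [Lf, Real.exp_log (by linarith), facR, show 2 * (k + 1) = (k + 1) * 2 by ring, pow_mul, e1, e2]
  have hlt : Real.exp (-((k + 1 : ℕ) * t)) < 1 := by
    have : (0 : ℝ) < (k + 1 : ℕ) * t := by positivity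
    exact Real.exp_lt_one_iff.2 (by linarith)
  have : 1 - Real.exp (-((k + 1 : ℕ) * t)) ^ 2 ≠ 0 := by nlinarith
  field_simp
  ring

/-- The constant. -/
noncomputable def AA : ℝ := Real.pi ^ 2 / 12 + 2 * Real.log ((1 + Real.sqrt 5) / 2) ^ 2

lemma AA_pos : 0 < AA := by
  have := Real.pi_pos
  unfold AA; positivity

/-- Asymptotics of the generating function on the real axis. -/
lemma FR_asymp : Tendsto (fun t : ℝ => FR (Real.exp (-t)) /
    (Real.sqrt (t / Real.pi) * Real.exp (AA / t))) (𝓝[>] 0) (𝓝 1) := by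
  have h1 : Tendsto (fun t : ℝ => ∑' k : ℕ, Lf ((k + 1 : ℕ) * t) -
      2 * Real.log ((1 + Real.sqrt 5) / 2) ^ 2 / t) (𝓝[>] 0) (𝓝 0) := by
    have : Tendsto (fun t : ℝ => 4 * t) (𝓝[>] 0) (𝓝 0) := by
      have : Continuous (fun t : ℝ => 4 * t) := by fun_prop
      exact (this.tendsto' 0 0 (by simp)).mono_left nhdsWithin_le_nhds
    refine squeeze_zero_norm' ?_ this
    filter_upwards [self_mem_nhdsWithin, Ioc_mem_nhdsGT (show (0 : ℝ) < 1 by norm_num)] with t ht ht1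
    rw [Real.norm_eq_abs, abs_sub_comm]
    exact Lf_sum ht ht1.2
  have h2 := ((Real.continuous_exp.tendsto _).comp h1).div EE_asymp one_ne_zero
  rw [Real.exp_zero, div_one] at h2
  refine h2.congr' ?_
  filter_upwards [self_mem_nhdsWithin] with t ht
  have ht : 0 < t := ht
  have hF := FR_mul_EE ht
  have hE : EE (Real.exp (-(2 * t))) ≠ 0 := by
    intro h
    rw [h, mul_zero] at hF
    exact (Real.exp_pos _).ne hF
  have hs : Real.sqrt (t / Real.pi) ≠ 0 := by
    have := Real.pi_pos
    positivity
  simp only [Pi.div_apply, Function.comp_apply]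
  rw [Real.exp_sub, ← hF]
  have e : Real.exp (AA / t) = Real.exp (Real.pi ^ 2 / (12 * t)) *
      Real.exp (2 * Real.log ((1 + Real.sqrt 5) / 2) ^ 2 / t) := by
    rw [← Real.exp_add, AA]; congr 1; field_simp
  rw [e]
  have p1 := (Real.exp_pos (Real.pi ^ 2 / (12 * t))).ne'
  have p2 := (Real.exp_pos (2 * Real.log ((1 + Real.sqrt 5) / 2) ^ 2 / t)).ne'
  rw [div_div, div_eq_div_iff (by positivity) (by positivity)]
  ring


/-- A light version of Vitali's theorem. -/
lemma vitali_aux {ι : Type*} {l : Filter ι} {R : ℝ} (hR : 0 < R) (k : ℕ) :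
    ∀ (D : ι → ℂ → ℂ) (C : ℝ), (∀ᶠ j in l, DifferentiableOn ℂ (D j) (Metric.ball 0 R)) →
    (∀ᶠ j in l, ∀ z ∈ Metric.ball (0 : ℂ) R, ‖D j z‖ ≤ C) →
    (∀ x : ℝ, 0 < x → x < R → Tendsto (fun j => D j x) l (𝓝 0)) →
    ∀ ε > 0, ∀ z ∈ Metric.ball (0 : ℂ) R, ∀ᶠ j in l, ‖D j z‖ ≤ ε + C * (2 * ‖z‖ / R) ^ k := by
  induction k with
  | zero =>
    intro D C hd hb h0 ε hε z hz
    filter_upwards [hb] with j hj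
    have := hj z hz
    simp; linarith
  | succ k ih =>
    intro D C hd hb h0 ε hε z hz
    rcases l.eq_or_neBot with rfl | hne
    · simp
    have hC : 0 ≤ C := by
      obtain ⟨j, hj⟩ := hb.exists
      exact (norm_nonneg _).trans (hj 0 (by simpa using hR))
    have hmaps : ∀ᶠ j in l, ∀ w ∈ Metric.ball (0 : ℂ) R, ‖dslope (D j) 0 w‖ ≤ 2 * C / R := by
      filter_upwards [hd, hb] with j hj hbj w hw
      refine Complex.norm_dslope_le_div_of_mapsTo_ball hj (fun v hv => ?_) hw
      rw [Metric.mem_closedBall, dist_eq_norm]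
      have h1 := hbj v hv
      have h2 := hbj 0 (by simpa using hR)
      have := norm_sub_le (D j v) (D j 0)
      linarith
    have hds : ∀ j (w : ℂ), D j w = D j 0 + w * dslope (D j) 0 w := by
      intro j w
      have := sub_smul_dslope (D j) 0 w
      simp only [sub_zero, smul_eq_mul] at this
      rw [this]; ring
    have hzero : Tendsto (fun j => D j 0) l (𝓝 0) := by
      rw [Metric.tendsto_nhds]
      intro δ hδ
      obtain ⟨x, hx0, hxR, hxδ⟩ : ∃ x : ℝ, 0 < x ∧ x < R ∧ x * (2 * C / R) < δ / 2 := by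
        have hpos : 0 < 2 * C / R + 1 := by positivity
        refine ⟨min (R / 2) (δ / 4 / (2 * C / R + 1)), by positivity, ?_, ?_⟩
        · exact (min_le_left _ _).trans_lt (by linarith)
        · have h1 : min (R / 2) (δ / 4 / (2 * C / R + 1)) * (2 * C / R) ≤
              δ / 4 / (2 * C / R + 1) * (2 * C / R + 1) :=
            mul_le_mul (min_le_right _ _) (by linarith) (by positivity) (by positivity)
          rw [div_mul_cancel₀ _ hpos.ne'] at h1
          linarith
      have hx := (Metric.tendsto_nhds.1 (h0 x hx0 hxR)) (δ / 2) (by positivity)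
      filter_upwards [hx, hmaps] with j h1 h2
      have h3 := h2 x (by simpa [abs_of_pos hx0] using hxR)
      rw [dist_zero_right] at h1 ⊢
      have h4 : D j 0 = D j x - x * dslope (D j) 0 x := by rw [hds j x]; ring
      rw [h4]
      refine (norm_sub_le _ _).trans_lt ?_
      rw [norm_mul]
      have h5 : ‖(x : ℂ)‖ = x := by simp [abs_of_pos hx0]
      rw [h5]
      have := mul_le_mul_of_nonneg_left h3 hx0.le
      linarith
    have hE : ∀ x : ℝ, 0 < x → x < R → Tendsto (fun j => dslope (D j) 0 (x : ℂ)) l (𝓝 0) := by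
      intro x hx0 hxR
      have hx : (x : ℂ) ≠ 0 := by exact_mod_cast hx0.ne'
      have h1 := ((h0 x hx0 hxR).sub hzero).const_mul (x : ℂ)⁻¹
      rw [sub_zero, mul_zero] at h1
      refine h1.congr fun j => ?_
      rw [hds j x]; field_simp; ring
    have hball : Metric.ball (0 : ℂ) R ∈ 𝓝 (0 : ℂ) := Metric.ball_mem_nhds _ hR
    have key := ih (fun j => dslope (D j) 0) (2 * C / R)
      (hd.mono fun j hj => (Complex.differentiableOn_dslope hball).2 hj) hmaps hE (ε / 2 / (‖z‖ + 1))
      (by positivity) z hz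
    have hz0 := (Metric.tendsto_nhds.1 hzero) (ε / 2) (by positivity)
    filter_upwards [key, hz0] with j h1 h2
    rw [dist_zero_right] at h2
    rw [hds j z]
    have h3 := mul_le_mul_of_nonneg_left h1 (norm_nonneg z)
    have h4 : ‖z‖ * (ε / 2 / (‖z‖ + 1)) ≤ ε / 2 := by
      have hp : 0 < ‖z‖ + 1 := by positivity
      calc ‖z‖ * (ε / 2 / (‖z‖ + 1)) ≤ (‖z‖ + 1) * (ε / 2 / (‖z‖ + 1)) := by gcongr; linarith
        _ = ε / 2 := by field_simp
    have h5 : ‖z‖ * (2 * C / R * (2 * ‖z‖ / R) ^ k) = C * (2 * ‖z‖ / R) ^ (k + 1) := by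
      rw [pow_succ]; ring
    have := norm_add_le (D j 0) (z * dslope (D j) 0 z)
    rw [norm_mul] at this
    linarith

lemma vitali {ι : Type*} {l : Filter ι} {R : ℝ} (hR : 0 < R)
    (D : ι → ℂ → ℂ) (C : ℝ) (hd : ∀ᶠ j in l, DifferentiableOn ℂ (D j) (Metric.ball 0 R))
    (hb : ∀ᶠ j in l, ∀ z ∈ Metric.ball (0 : ℂ) R, ‖D j z‖ ≤ C)
    (h0 : ∀ x : ℝ, 0 < x → x < R → Tendsto (fun j => D j x) l (𝓝 0))
    (z : ℂ) (hz : ‖z‖ < R / 2) : Tendsto (fun j => D j z) l (𝓝 0) := by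
  rw [Metric.tendsto_nhds]
  intro ε hε
  have h1 : Tendsto (fun k : ℕ => C * (2 * ‖z‖ / R) ^ k) atTop (𝓝 0) := by
    have := (tendsto_pow_atTop_nhds_zero_of_lt_one (r := 2 * ‖z‖ / R) (by positivity)
      (by rw [div_lt_one hR]; linarith)).const_mul C
    simpa using this
  obtain ⟨k, hk⟩ := (h1.eventually (gt_mem_nhds (half_pos hε))).exists
  have := vitali_aux hR k D C hd hb h0 (ε / 3) (by positivity) z (by simp; linarith)
  filter_upwards [this] with j hj
  rw [dist_zero_right]
  linarith

/-- Coefficients including the constant term. -/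
noncomputable def cf (n : ℕ) : ℝ := (paE Odd n : ℝ) + if n = 0 then 1 else 0

lemma cf_nonneg (n : ℕ) : 0 ≤ cf n := by unfold cf; positivity

lemma cf_pos_eq {n : ℕ} (hn : 0 < n) : cf n = paE Odd n := by simp [cf, hn.ne']

lemma summable_cf {r : ℝ} (h0 : 0 < r) (h1 : r < 1) : Summable (fun n => cf n * r ^ n) := by
  have h := (summable_paOdd h0 h1).add
    (hasSum_single (f := fun n : ℕ => if n = 0 then (1 : ℝ) else 0) 0 (by simp +contextual)).summable
  refine h.congr fun n => ?_
  by_cases hn : n = 0 <;> simp [cf, hn]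

lemma FF_eq_cf {q : ℂ} (h0 : 0 < ‖q‖) (h1 : ‖q‖ < 1) :
    HasSum (fun n => (cf n : ℂ) * q ^ n) (FF q) := by
  have h := ((paOdd_gf h0 h1).1.summable.hasSum).add
    (hasSum_single (f := fun n : ℕ => if n = 0 then (1 : ℂ) else 0) 0 (by simp +contextual))
  rw [FF, add_comm]
  convert! h using 1
  ext n
  by_cases hn : n = 0 <;> simp [cf, hn]

lemma norm_FF_le_FR {q : ℂ} (h0 : 0 < ‖q‖) (h1 : ‖q‖ < 1) : ‖FF q‖ ≤ FR ‖q‖ := by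
  refine le_of_tendsto_of_tendsto' (tendsto_PP h0 h1).norm (tendsto_PR h0 h1)
    (fun m => norm_PP_le_PR h0 h1 m)

lemma FF_diff {r : ℝ} (h0 : 0 < r) (h1 : r < 1) : DifferentiableOn ℂ FF (Metric.ball 0 r) := by
  unfold FF
  refine DifferentiableOn.const_add _ ?_
  refine Complex.differentiableOn_tsum_of_summable_norm (summable_paOdd h0 h1) (fun n => by fun_prop)
    Metric.isOpen_ball fun n w hw => ?_
  rw [norm_mul, norm_pow]
  have : ‖w‖ < r := by simpa using hw
  simp only [Complex.norm_natCast]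
  gcongr

/-- Fourier coefficients. -/
lemma fourier_coef {c : ℕ → ℂ} {r : ℝ} (h0 : 0 < r) (hs : Summable fun k => ‖c k‖ * r ^ k) (n : ℕ) :
    ∫ θ in (-Real.pi)..Real.pi, (∑' k, c k * ((r : ℂ) * Complex.exp (θ * Complex.I)) ^ k) *
      Complex.exp (-(n * θ * Complex.I)) = 2 * Real.pi * c n * r ^ n := by
  have hnorm : ∀ k (θ : ℝ), ‖c k * ((r : ℂ) * Complex.exp (θ * Complex.I)) ^ k‖ = ‖c k‖ * r ^ k := by
    intro k θ
    rw [norm_mul, norm_pow, norm_mul, Complex.norm_exp_ofReal_mul_I]; simp [abs_of_pos h0]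
  have hnorm2 : ∀ θ : ℝ, ‖Complex.exp (-(n * θ * Complex.I))‖ = 1 := by
    intro θ
    rw [show -((n : ℂ) * θ * Complex.I) = ((-(n * θ) : ℝ) : ℂ) * Complex.I by push_cast; ring,
      Complex.norm_exp_ofReal_mul_I]
  have h := intervalIntegral.hasSum_integral_of_dominated_convergence
    (μ := MeasureTheory.volume) (a := -Real.pi) (b := Real.pi)
    (F := fun (k : ℕ) (θ : ℝ) => c k * ((r : ℂ) * Complex.exp (θ * Complex.I)) ^ k *
      Complex.exp (-(n * θ * Complex.I)))
    (f := fun θ : ℝ => (∑' k, c k * ((r : ℂ) * Complex.exp (θ * Complex.I)) ^ k) *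
      Complex.exp (-(n * θ * Complex.I)))
    (fun k _ => ‖c k‖ * r ^ k)
    (fun k => by
      apply Continuous.aestronglyMeasurable
      fun_prop)
    (fun k => Filter.Eventually.of_forall fun θ _ => by rw [norm_mul, hnorm, hnorm2, mul_one])
    (Filter.Eventually.of_forall fun θ _ => hs)
    (by simp)
    (Filter.Eventually.of_forall fun θ _ => by
      apply HasSum.mul_right
      apply Summable.hasSum
      apply Summable.of_norm
      simpa only [hnorm] using hs)
  have hval : ∀ k : ℕ, ∫ θ in (-Real.pi)..Real.pi, c k * ((r : ℂ) * Complex.exp (θ * Complex.I)) ^ k *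
      Complex.exp (-(n * θ * Complex.I)) = if k = n then 2 * Real.pi * c n * r ^ n else 0 := by
    intro k
    have e : ∀ θ : ℝ, c k * ((r : ℂ) * Complex.exp (θ * Complex.I)) ^ k *
      Complex.exp (-(n * θ * Complex.I)) =
      c k * r ^ k * Complex.exp ((((k : ℤ) - n : ℤ) : ℂ) * Complex.I * θ) := by
      intro θ
      rw [mul_pow, ← Complex.exp_nat_mul, mul_assoc, mul_assoc, mul_assoc, mul_assoc, ← Complex.exp_add]
      congr 3
      push_cast; ring_nf
    simp_rw [e]
    rw [intervalIntegral.integral_const_mul]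
    by_cases hk : k = n
    · subst hk
      simp
      ring
    · rw [if_neg hk, integral_exp_mul_complex]
      · have : Complex.exp ((((k : ℤ) - n : ℤ) : ℂ) * Complex.I * (Real.pi : ℝ)) =
          Complex.exp ((((k : ℤ) - n : ℤ) : ℂ) * Complex.I * ((-Real.pi : ℝ) : ℂ)) := by
          rw [Complex.exp_eq_exp_iff_exists_int]
          exact ⟨(k : ℤ) - n, by push_cast; ring⟩
        rw [this]; simp
      · apply mul_ne_zero _ Complex.I_ne_zero
        have : (k : ℤ) - n ≠ 0 := by omega
        exact_mod_cast this
  simp_rw [hval] at h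
  have h2 := hasSum_ite_eq n (2 * (Real.pi : ℂ) * c n * r ^ n)
  exact h.unique h2


/-- The uniform decay bound. -/
lemma decay {s y : ℝ} (hs : 0 < s) (hs1 : s ≤ 1) (hy : |s ^ 3 * y| ≤ Real.pi) :
    Real.exp (-(SS (Real.exp (-s ^ 2)) (s ^ 3 * y)) / 8) ≤ 528 * 360 ^ 3 * (1 + y ^ 2)⁻¹ := by
  have h1 := SS_ge (t := s ^ 2) (θ := s ^ 3 * y) (by positivity) (by nlinarith) hy
  set X := y ^ 2 / (1 + s ^ 2 * y ^ 2) with hX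
  have hX0 : 0 ≤ X := by positivity
  have e1 : (s ^ 3 * y) ^ 2 / (s ^ 2 * ((s ^ 2) ^ 2 + (s ^ 3 * y) ^ 2)) = X := by
    rw [hX]; field_simp
  rw [e1] at h1
  have h2 : Real.exp (-(SS (Real.exp (-s ^ 2)) (s ^ 3 * y)) / 8) ≤ Real.exp (-(X / 360)) := by
    apply Real.exp_le_exp.2; linarith
  refine h2.trans ?_
  rw [← div_eq_mul_inv, le_div_iff₀ (by positivity)]
  rcases le_total (y ^ 2) 1 with h | h
  · have : Real.exp (-(X / 360)) ≤ 1 := Real.exp_le_one_iff.2 (by linarith [div_nonneg hX0 (by norm_num : (0:ℝ) ≤ 360)])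
    nlinarith
  · have hp : (s ^ 3 * y) ^ 2 ≤ 10 := by
      have := sq_le_sq' (by linarith [abs_nonneg (s ^ 3 * y), Real.pi_pos]) hy
      rw [sq_abs] at this
      have := Real.pi_lt_d2
      nlinarith [Real.pi_pos]
    have h3 : (1 + s ^ 2 * y ^ 2) ^ 3 ≤ 44 * (y ^ 2) ^ 2 := by
      have a0 : 0 ≤ s ^ 2 * y ^ 2 := by positivity
      have a1 : (1 + s ^ 2 * y ^ 2) ^ 3 ≤ 4 * (1 + (s ^ 2 * y ^ 2) ^ 3) := by
        nlinarith [mul_nonneg (by linarith : 0 ≤ 1 + s ^ 2 * y ^ 2) (sq_nonneg (1 - s ^ 2 * y ^ 2))]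
      have a2 : (s ^ 2 * y ^ 2) ^ 3 = (s ^ 3 * y) ^ 2 * (y ^ 2) ^ 2 := by ring
      have a3 : (s ^ 3 * y) ^ 2 * (y ^ 2) ^ 2 ≤ 10 * (y ^ 2) ^ 2 := by gcongr
      nlinarith
    have h4 : y ^ 2 ≤ 44 * X ^ 3 := by
      rw [hX, div_pow, ← mul_div_assoc, le_div_iff₀ (by positivity)]
      calc y ^ 2 * (1 + s ^ 2 * y ^ 2) ^ 3 ≤ y ^ 2 * (44 * (y ^ 2) ^ 2) := by gcongr
        _ = _ := by ring
    have h5 := Real.pow_div_factorial_le_exp (X / 360) (by positivity) 3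
    have h6 : Real.exp (-(X / 360)) * Real.exp (X / 360) = 1 := by rw [← Real.exp_add]; simp
    have h7 : 0 < Real.exp (-(X / 360)) := Real.exp_pos _
    simp only [Nat.factorial] at h5
    have h8 : 1 + y ^ 2 ≤ 528 * 360 ^ 3 * Real.exp (X / 360) := by
      push_cast at h5
      nlinarith
    calc Real.exp (-(X / 360)) * (1 + y ^ 2) ≤
        Real.exp (-(X / 360)) * (528 * 360 ^ 3 * Real.exp (X / 360)) := by gcongr
      _ = 528 * 360 ^ 3 * (Real.exp (-(X / 360)) * Real.exp (X / 360)) := by ring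
      _ = _ := by rw [h6, mul_one]

/-- The normalized generating function. -/
noncomputable def MM (s : ℝ) (y : ℂ) : ℂ :=
  FF (Complex.exp (-(s : ℂ) ^ 2 - (s : ℂ) ^ 3 * y)) * Complex.exp (AA * y / s) /
    (FR (Real.exp (-s ^ 2)) : ℂ)

/-- The normalized generating function on the reals. -/
noncomputable def MR (s x : ℝ) : ℝ :=
  FR (Real.exp (-(s ^ 2 * (1 + s * x)))) * Real.exp (AA * x / s) / FR (Real.exp (-s ^ 2))

lemma MM_ofReal (s x : ℝ) : MM s x = MR s x := by
  rw [MM, MR, Complex.ofReal_div, Complex.ofReal_mul,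
    ← FF_ofReal (Real.exp (-(s ^ 2 * (1 + s * x)))), Complex.ofReal_exp,
    Complex.ofReal_exp]
  congr 3
  · push_cast; ring_nf
  · push_cast; ring_nf

lemma norm_exp_arg (s : ℝ) (y : ℂ) : ‖Complex.exp (-(s : ℂ) ^ 2 - (s : ℂ) ^ 3 * y)‖ =
    Real.exp (-(s ^ 2 * (1 + s * y.re))) := by
  rw [Complex.norm_exp]
  congr 1
  have : (s : ℂ) ^ 3 * y = ((s ^ 3 : ℝ) : ℂ) * y := by push_cast; ring
  rw [this, Complex.sub_re, Complex.re_ofReal_mul]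
  have : -(s : ℂ) ^ 2 = ((-s ^ 2 : ℝ) : ℂ) := by push_cast; ring
  rw [this, Complex.ofReal_re]; ring

lemma norm_MM_le {s : ℝ} (hs : 0 < s) {y : ℂ} (hy : 0 < 1 + s * y.re) : ‖MM s y‖ ≤ MR s y.re := by
  have h := norm_FF_le_FR (q := Complex.exp (-(s : ℂ) ^ 2 - (s : ℂ) ^ 3 * y))
    (by rw [norm_exp_arg]; positivity) (by rw [norm_exp_arg]; simp; positivity)
  rw [norm_exp_arg] at h
  have hF : 0 < FR (Real.exp (-s ^ 2)) := by linarith [FR_ge_one (Real.exp_pos (-s ^ 2))]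
  rw [MM, MR, norm_div, norm_mul, Complex.norm_exp]
  have e : (AA * y / s : ℂ).re = AA * y.re / s := by
    rw [Complex.div_ofReal_re, Complex.re_ofReal_mul]
  rw [e, Complex.norm_real, Real.norm_of_nonneg hF.le]
  gcongr

lemma MM_diff {s R : ℝ} (hs : 0 < s) (hR : s * R ≤ 1 / 2) :
    DifferentiableOn ℂ (MM s) (Metric.ball 0 R) := by
  unfold MM
  refine DifferentiableOn.div_const (DifferentiableOn.mul ?_ (by fun_prop)) _
  have h1 := FF_diff (r := Real.exp (-(s ^ 2 * (1 / 2)))) (Real.exp_pos _) (by simp; positivity)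
  refine h1.comp (by fun_prop) fun y hy => ?_
  rw [mem_ball_zero_iff] at hy ⊢
  rw [norm_exp_arg]
  have h2 := Complex.abs_re_le_norm y
  have h3 : -R < y.re := by linarith [neg_abs_le y.re]
  apply Real.exp_lt_exp.2
  have : s * (-R) < s * y.re := by gcongr
  have h4 : 0 < s ^ 2 := by positivity
  nlinarith

lemma MR_eq {s x : ℝ} (hs : 0 < s) (hx : 0 < 1 + s * x) :
    MR s x = (FR (Real.exp (-(s ^ 2 * (1 + s * x)))) / (Real.sqrt (s ^ 2 * (1 + s * x) / Real.pi) *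
      Real.exp (AA / (s ^ 2 * (1 + s * x))))) / (FR (Real.exp (-s ^ 2)) /
      (Real.sqrt (s ^ 2 / Real.pi) * Real.exp (AA / s ^ 2))) * (Real.sqrt (1 + s * x) *
      Real.exp (AA * x ^ 2 / (1 + s * x))) := by
  have hF : 0 < FR (Real.exp (-s ^ 2)) := by linarith [FR_ge_one (Real.exp_pos (-s ^ 2))]
  have e1 : Real.sqrt (s ^ 2 * (1 + s * x) / Real.pi) =
      Real.sqrt (s ^ 2 / Real.pi) * Real.sqrt (1 + s * x) := by
    rw [← Real.sqrt_mul (by positivity)]; congr 1; ring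
  have h2 : 0 < Real.sqrt (s ^ 2 / Real.pi) := Real.sqrt_pos.2 (by positivity)
  have h3 : 0 < Real.sqrt (1 + s * x) := Real.sqrt_pos.2 hx
  have e2 : Real.exp (AA * x / s) * Real.exp (AA / (s ^ 2 * (1 + s * x))) =
      Real.exp (AA / s ^ 2) * Real.exp (AA * x ^ 2 / (1 + s * x)) := by
    rw [← Real.exp_add, ← Real.exp_add]; congr 1
    have := hx.ne'
    rw [div_add_div _ _ (by positivity) (by positivity), div_add_div _ _ (by positivity) (by positivity),
      div_eq_div_iff (by positivity) (by positivity)]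
    ring
  have h4 := Real.exp_pos (AA / (s ^ 2 * (1 + s * x)))
  rw [MR, e1]
  generalize Real.exp (AA * x / s) = a at *
  generalize Real.exp (AA / (s ^ 2 * (1 + s * x))) = b at *
  generalize Real.exp (AA / s ^ 2) = c at *
  generalize Real.exp (AA * x ^ 2 / (1 + s * x)) = d at *
  field_simp
  linear_combination FR (Real.exp (-(s ^ 2 * (1 + s * x)))) * e2

lemma MR_bound {R : ℝ} (hR : 0 < R) : ∀ᶠ s in 𝓝[>] (0 : ℝ), ∀ x : ℝ, |x| < R →
    MR s x ≤ 8 * Real.exp (2 * AA * R ^ 2) := by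
  have h1 : ∀ᶠ t in 𝓝[>] (0 : ℝ), FR (Real.exp (-t)) /
    (Real.sqrt (t / Real.pi) * Real.exp (AA / t)) ∈ Set.Icc (1 / 2 : ℝ) 2 :=
    FR_asymp (Icc_mem_nhds (by norm_num) (by norm_num))
  obtain ⟨t0, ht0, H⟩ := mem_nhdsGT_iff_exists_Ioo_subset.1 h1
  have ht0' : (0 : ℝ) < t0 := ht0
  have h2 : ∀ᶠ s in 𝓝[>] (0 : ℝ), s * R < 1 / 2 := by
    have : Tendsto (fun s : ℝ => s * R) (𝓝[>] 0) (𝓝 (0 * R)) :=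
      tendsto_nhdsWithin_of_tendsto_nhds ((continuous_id.mul continuous_const).tendsto 0)
    exact this.eventually (gt_mem_nhds (by simp))
  have h3 : ∀ᶠ s in 𝓝[>] (0 : ℝ), s ^ 2 * 2 < t0 := by
    have : Tendsto (fun s : ℝ => s ^ 2 * 2) (𝓝[>] 0) (𝓝 (0 ^ 2 * 2)) :=
      tendsto_nhdsWithin_of_tendsto_nhds (((continuous_id.pow 2).mul continuous_const).tendsto 0)
    exact this.eventually (gt_mem_nhds (by simpa using ht0'))
  filter_upwards [h2, h3, self_mem_nhdsWithin] with s a1 a2 hs x hx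
  have hs0 : (0 : ℝ) < s := hs
  have b1 : |s * x| < 1 / 2 := by
    rw [abs_mul, abs_of_pos hs0]
    exact (mul_lt_mul_of_pos_left hx hs0).trans a1
  obtain ⟨b2, b3⟩ := abs_lt.1 b1
  have hs2 : 0 < s ^ 2 := by positivity
  have c1 := H (show s ^ 2 * (1 + s * x) ∈ Set.Ioo 0 t0 from ⟨by apply mul_pos hs2; linarith, by nlinarith⟩)
  have c2 := H (show s ^ 2 ∈ Set.Ioo 0 t0 from ⟨hs2, by nlinarith⟩)
  simp only [Set.mem_ofPred_eq, Set.mem_Icc] at c1 c2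
  rw [MR_eq hs0 (by linarith)]
  have c3 : Real.sqrt (1 + s * x) ≤ 2 := by
    rw [Real.sqrt_le_left (by norm_num)]; linarith
  have c4 : Real.exp (AA * x ^ 2 / (1 + s * x)) ≤ Real.exp (2 * AA * R ^ 2) := by
    apply Real.exp_le_exp.2
    rw [div_le_iff₀ (by linarith)]
    have : x ^ 2 ≤ R ^ 2 := by
      have := sq_le_sq' (by linarith [abs_nonneg x]) hx.le
      rwa [sq_abs] at this
    have hA := AA_pos
    calc AA * x ^ 2 ≤ AA * R ^ 2 := by gcongr
      _ = 2 * AA * R ^ 2 * (1 / 2) := by ring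
      _ ≤ _ := by gcongr; linarith
  have c5 : ∀ a b : ℝ, (1 / 2 ≤ a ∧ a ≤ 2) → (1 / 2 ≤ b ∧ b ≤ 2) → a / b ≤ 4 ∧ 0 ≤ a / b := by
    rintro a b ⟨_, h⟩ ⟨h', _⟩
    refine ⟨by rw [div_le_iff₀ (by linarith)]; linarith, div_nonneg (by linarith) (by linarith)⟩
  obtain ⟨c6, c7⟩ := c5 _ _ c1 c2
  calc _ ≤ 4 * (2 * Real.exp (2 * AA * R ^ 2)) := by
        apply mul_le_mul c6 _ (by positivity) (by norm_num)
        exact (mul_le_mul_of_nonneg_left c4 (by positivity)).trans (by gcongr)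
    _ = _ := by ring

lemma MR_tendsto (x : ℝ) : Tendsto (fun s => MR s x) (𝓝[>] 0) (𝓝 (Real.exp (AA * x ^ 2))) := by
  have g0 : Tendsto (fun s : ℝ => 1 + s * x) (𝓝[>] 0) (𝓝 1) := by
    have : Tendsto (fun s : ℝ => 1 + s * x) (𝓝[>] 0) (𝓝 (1 + 0 * x)) :=
      tendsto_nhdsWithin_of_tendsto_nhds (Continuous.tendsto (by fun_prop) 0)
    simpa using this
  have hpos : ∀ᶠ s in 𝓝[>] (0 : ℝ), 0 < 1 + s * x := g0.eventually (lt_mem_nhds one_pos)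
  have g1 : Tendsto (fun s : ℝ => s ^ 2) (𝓝[>] 0) (𝓝[>] 0) := by
    refine tendsto_nhdsWithin_iff.2 ⟨?_, ?_⟩
    · have : Tendsto (fun s : ℝ => s ^ 2) (𝓝[>] 0) (𝓝 (0 ^ 2)) :=
        tendsto_nhdsWithin_of_tendsto_nhds (Continuous.tendsto (by fun_prop) 0)
      simpa using this
    · filter_upwards [self_mem_nhdsWithin] with s hs
      have : (0 : ℝ) < s := hs
      simp only [Set.mem_Ioi]; positivity
  have g2 : Tendsto (fun s : ℝ => s ^ 2 * (1 + s * x)) (𝓝[>] 0) (𝓝[>] 0) := by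
    refine tendsto_nhdsWithin_iff.2 ⟨?_, ?_⟩
    · have := (tendsto_nhdsWithin_iff.1 g1).1.mul g0
      simpa using this
    · filter_upwards [self_mem_nhdsWithin, hpos] with s hs h
      have : (0 : ℝ) < s := hs
      simp only [Set.mem_Ioi]; positivity
  have k1 := (FR_asymp.comp g2).div (FR_asymp.comp g1) one_ne_zero
  have k2 : Tendsto (fun s : ℝ => Real.sqrt (1 + s * x)) (𝓝[>] 0) (𝓝 1) := by
    simpa [Function.comp_def] using (Real.continuous_sqrt.tendsto 1).comp g0
  have k3 : Tendsto (fun s : ℝ => Real.exp (AA * x ^ 2 / (1 + s * x))) (𝓝[>] 0)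
      (𝓝 (Real.exp (AA * x ^ 2))) := by
    have := (Real.continuous_exp.tendsto _).comp ((tendsto_const_nhds (x := AA * x ^ 2)).div g0 one_ne_zero)
    simpa [Function.comp_def] using this
  have k4 := k1.mul (k2.mul k3)
  simp only [div_one, one_mul] at k4
  refine k4.congr' ?_
  filter_upwards [self_mem_nhdsWithin, hpos] with s hs h
  exact (MR_eq hs h).symm

lemma MM_tendsto (z : ℂ) : Tendsto (fun s => MM s z) (𝓝[>] 0) (𝓝 (Complex.exp (AA * z ^ 2))) := by
  set R := 2 * ‖z‖ + 1 with hRdef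
  have hR : 0 < R := by positivity
  have h2 : ∀ᶠ s in 𝓝[>] (0 : ℝ), s * R < 1 / 2 := by
    have : Tendsto (fun s : ℝ => s * R) (𝓝[>] 0) (𝓝 (0 * R)) :=
      tendsto_nhdsWithin_of_tendsto_nhds ((continuous_id.mul continuous_const).tendsto 0)
    exact this.eventually (gt_mem_nhds (by simp))
  have key := vitali (l := 𝓝[>] (0 : ℝ)) hR (fun s y => MM s y - Complex.exp (AA * y ^ 2))
    (8 * Real.exp (2 * AA * R ^ 2) + Real.exp (AA * R ^ 2)) ?_ ?_ ?_ z (by rw [hRdef]; linarith)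
  · have := key.add_const (Complex.exp (AA * z ^ 2))
    simpa using this
  · filter_upwards [h2, self_mem_nhdsWithin] with s a hs
    exact (MM_diff hs a.le).sub (by fun_prop)
  · filter_upwards [h2, self_mem_nhdsWithin, MR_bound hR] with s a hs hb y hy
    have hs0 : (0 : ℝ) < s := hs
    rw [mem_ball_zero_iff] at hy
    have hre := (Complex.abs_re_le_norm y).trans_lt hy
    refine (norm_sub_le _ _).trans (add_le_add ?_ ?_)
    · refine (norm_MM_le hs0 ?_).trans (hb _ hre)
      have : s * (-R) < s * y.re := by
        gcongr; exact (abs_lt.1 hre).1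
      linarith
    · rw [Complex.norm_exp]
      apply Real.exp_le_exp.2
      refine (Complex.re_le_norm _).trans ?_
      rw [norm_mul, norm_pow, Complex.norm_real, Real.norm_of_nonneg AA_pos.le]
      have := AA_pos
      gcongr
  · intro x _ _
    have := (Complex.continuous_ofReal.tendsto _).comp (MR_tendsto x)
    have h3 := this.sub_const (Complex.exp (AA * x ^ 2))
    simp only [Function.comp_def] at h3
    simp only [MM_ofReal]
    convert! h3 using 1
    push_cast; simp


lemma exp_arg (s y : ℝ) : Complex.exp (-(s : ℂ) ^ 2 - (s : ℂ) ^ 3 * (-(Complex.I * y))) =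
    (Real.exp (-s ^ 2) : ℂ) * Complex.exp (((s ^ 3 * y : ℝ) : ℂ) * Complex.I) := by
  rw [Complex.ofReal_exp, ← Complex.exp_add]
  congr 1
  push_cast; ring

lemma FR_exp_pos (s : ℝ) : 0 < FR (Real.exp (-s ^ 2)) := by
  linarith [FR_ge_one (Real.exp_pos (-s ^ 2))]

lemma exp_sq_lt {s : ℝ} (hs : 0 < s) : Real.exp (-s ^ 2) < 1 := by
  simp; positivity

lemma MM_im_eq (s y : ℝ) : MM s (-(Complex.I * y)) =
    FF ((Real.exp (-s ^ 2) : ℂ) * Complex.exp (((s ^ 3 * y : ℝ) : ℂ) * Complex.I)) *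
      Complex.exp (-(((AA * y / s : ℝ) : ℂ) * Complex.I)) / (FR (Real.exp (-s ^ 2)) : ℂ) := by
  rw [MM, exp_arg]
  congr 3
  push_cast; ring

lemma norm_MM_im {s y : ℝ} (hs : 0 < s) (hs1 : s ≤ 1) (hy : |s ^ 3 * y| ≤ Real.pi) :
    ‖MM s (-(Complex.I * y))‖ ≤ 528 * 360 ^ 3 * (1 + y ^ 2)⁻¹ := by
  refine le_trans ?_ (decay hs hs1 hy)
  have hF := FR_exp_pos s
  rw [MM_im_eq, norm_div, norm_mul, ← neg_mul, ← Complex.ofReal_neg, Complex.norm_exp_ofReal_mul_I,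
    mul_one, Complex.norm_real, Real.norm_of_nonneg hF.le, div_le_iff₀ hF, mul_comm (Real.exp _) (FR _)]
  exact norm_FF_le (Real.exp_pos _) (exp_sq_lt hs)

lemma MM_im_cont {s : ℝ} (hs : 0 < s) : Continuous (fun y : ℝ => MM s (-(Complex.I * y))) := by
  simp_rw [MM_im_eq]
  refine Continuous.div_const (Continuous.mul ?_ (by fun_prop)) _
  have hd := FF_diff (r := Real.exp (-(s ^ 2 * (1 / 2)))) (Real.exp_pos _) (by simp; positivity)
  refine hd.continuousOn.comp_continuous (by fun_prop) fun y => ?_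
  rw [mem_ball_zero_iff, norm_mul, Complex.norm_exp_ofReal_mul_I, mul_one, Complex.norm_real,
    Real.norm_of_nonneg (Real.exp_pos _).le]
  apply Real.exp_lt_exp.2
  have : 0 < s ^ 2 := by positivity
  linarith

lemma int_tendsto : Tendsto (fun s : ℝ => ∫ y in (-(Real.pi / s ^ 3))..(Real.pi / s ^ 3),
    MM s (-(Complex.I * y))) (𝓝[>] 0) (𝓝 (Real.sqrt (Real.pi / AA) : ℂ)) := by
  have key : Tendsto (fun s : ℝ => ∫ y : ℝ, (Set.Ioc (-(Real.pi / s ^ 3)) (Real.pi / s ^ 3)).indicator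
      (fun y : ℝ => MM s (-(Complex.I * y))) y) (𝓝[>] 0)
      (𝓝 (∫ y : ℝ, ((Real.exp (-AA * y ^ 2) : ℝ) : ℂ))) := by
    have h1 : ∀ᶠ s in 𝓝[>] (0 : ℝ), s < 1 := by
      have : Set.Iio (1 : ℝ) ∈ 𝓝 (0 : ℝ) := Iio_mem_nhds one_pos
      exact mem_nhdsWithin_of_mem_nhds this
    refine MeasureTheory.tendsto_integral_filter_of_dominated_convergence
      (fun y => 528 * 360 ^ 3 * (1 + y ^ 2)⁻¹) ?_ ?_ (integrable_inv_one_add_sq.const_mul _) ?_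
    · filter_upwards [self_mem_nhdsWithin] with s hs
      exact (MM_im_cont hs).aestronglyMeasurable.indicator measurableSet_Ioc
    · filter_upwards [self_mem_nhdsWithin, h1] with s hs h1
      have hs0 : (0 : ℝ) < s := hs
      refine Eventually.of_forall fun y => ?_
      by_cases hy : y ∈ Set.Ioc (-(Real.pi / s ^ 3)) (Real.pi / s ^ 3)
      · rw [Set.indicator_of_mem hy]
        apply norm_MM_im hs0 h1.le
        have : |y| ≤ Real.pi / s ^ 3 := abs_le.2 ⟨hy.1.le, hy.2⟩
        rw [abs_mul, abs_of_pos (by positivity), mul_comm]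
        exact (le_div_iff₀ (by positivity)).1 this
      · rw [Set.indicator_of_notMem hy, norm_zero]
        positivity
    · refine Eventually.of_forall fun y => ?_
      have h2 : ∀ᶠ s in 𝓝[>] (0 : ℝ), s ^ 3 * (|y| + 1) < Real.pi := by
        have : Tendsto (fun s : ℝ => s ^ 3 * (|y| + 1)) (𝓝[>] 0) (𝓝 (0 ^ 3 * (|y| + 1))) :=
          tendsto_nhdsWithin_of_tendsto_nhds (Continuous.tendsto (by fun_prop) 0)
        exact this.eventually (gt_mem_nhds (by simpa using Real.pi_pos))
      have h3 := MM_tendsto (-(Complex.I * y))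
      have e : Complex.exp (AA * (-(Complex.I * y)) ^ 2) = ((Real.exp (-AA * y ^ 2) : ℝ) : ℂ) := by
        rw [Complex.ofReal_exp]; congr 1; push_cast
        rw [neg_sq, mul_pow, Complex.I_sq]; ring
      rw [e] at h3
      refine h3.congr' ?_
      filter_upwards [self_mem_nhdsWithin, h2] with s hs h2
      have hs0 : (0 : ℝ) < s := hs
      have h4 : |y| < Real.pi / s ^ 3 := by
        rw [lt_div_iff₀ (by positivity)]
        have : 0 < s ^ 3 := by positivity
        nlinarith
      rw [Set.indicator_of_mem]
      exact ⟨(abs_lt.1 h4).1, (abs_lt.1 h4).2.le⟩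
  rw [integral_complex_ofReal, integral_gaussian] at key
  refine key.congr' ?_
  filter_upwards [self_mem_nhdsWithin] with s hs
  have hs0 : (0 : ℝ) < s := hs
  rw [MeasureTheory.integral_indicator measurableSet_Ioc, intervalIntegral.integral_of_le]
  have : 0 < Real.pi / s ^ 3 := by positivity
  linarith

lemma cf_int {s : ℝ} (hs : 0 < s) {n : ℕ} (hn : (n : ℝ) * s ^ 4 = AA) :
    ∫ y in (-(Real.pi / s ^ 3))..(Real.pi / s ^ 3), MM s (-(Complex.I * y)) =
      ((2 * Real.pi * (cf n * Real.exp (-s ^ 2) ^ n / (FR (Real.exp (-s ^ 2)) * s ^ 3)) : ℝ) : ℂ) := by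
  set r := Real.exp (-s ^ 2) with hr
  have hF := FR_exp_pos s
  rw [← hr] at hF
  have h1 : r < 1 := exp_sq_lt hs
  have h0 : 0 < r := Real.exp_pos _
  have h := fourier_coef (c := fun n => (cf n : ℂ)) h0 (by
    simpa [abs_of_nonneg (cf_nonneg _)] using summable_cf h0 h1) n
  have e1 : ∀ θ : ℝ, ∑' k, (cf k : ℂ) * ((r : ℂ) * Complex.exp (θ * Complex.I)) ^ k =
      FF ((r : ℂ) * Complex.exp (θ * Complex.I)) := by
    intro θ
    have hn : ‖(r : ℂ) * Complex.exp (θ * Complex.I)‖ = r := by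
      rw [norm_mul, Complex.norm_exp_ofReal_mul_I, mul_one, Complex.norm_real,
        Real.norm_of_nonneg h0.le]
    exact (FF_eq_cf (by rwa [hn]) (by rwa [hn])).tsum_eq
  simp_rw [e1] at h
  have hsub := intervalIntegral.integral_comp_mul_left (a := -(Real.pi / s ^ 3)) (b := Real.pi / s ^ 3)
    (fun θ : ℝ => FF ((r : ℂ) * Complex.exp (θ * Complex.I)) * Complex.exp (-(n * θ * Complex.I)))
    (c := s ^ 3) (by positivity)
  have e2 : s ^ 3 * -(Real.pi / s ^ 3) = -Real.pi := by field_simp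
  have e3 : s ^ 3 * (Real.pi / s ^ 3) = Real.pi := by field_simp
  rw [e2, e3, h] at hsub
  have e4 : ∀ y : ℝ, MM s (-(Complex.I * y)) =
      FF ((r : ℂ) * Complex.exp (((s ^ 3 * y : ℝ) : ℂ) * Complex.I)) *
        Complex.exp (-(n * ((s ^ 3 * y : ℝ) : ℂ) * Complex.I)) * (FR r : ℂ)⁻¹ := by
    intro y
    rw [MM_im_eq, div_eq_mul_inv]
    congr 4
    rw [← hn]
    push_cast
    have : (s : ℂ) ≠ 0 := by exact_mod_cast hs.ne'
    field_simp
  simp_rw [e4]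
  rw [intervalIntegral.integral_mul_const, hsub, Complex.real_smul]
  push_cast
  have : (s : ℂ) ≠ 0 := by exact_mod_cast hs.ne'
  have : (FR r : ℂ) ≠ 0 := by exact_mod_cast hF.ne'
  field_simp

/-- The generating function for even smallest part. -/
lemma eps_term {r : ℝ} (h0 : 0 < r) (h1 : r < 1) (m : ℕ) :
    (r ^ (m + 1)) ^ 2 / (1 - (r ^ (m + 1)) ^ 2) * Real.exp (-(r ^ (m + 1) / (1 - r)) / 4) ≤
      140 * Real.sqrt (1 - r) ^ 3 * Real.sqrt r ^ (m + 1) := by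
  obtain ⟨a, b, -, c⟩ := pow_facts h0 h1 (k := m + 1) (by omega)
  set x := r ^ (m + 1) with hx
  set η := Real.sqrt (1 - r) with hη
  set X := Real.sqrt r ^ (m + 1) with hX
  have hη0 : 0 < η := Real.sqrt_pos.2 (by linarith)
  have hη2 : η ^ 2 = 1 - r := Real.sq_sqrt (by linarith)
  have hX0 : 0 < X := pow_pos (Real.sqrt_pos.2 h0) _
  have hX2 : X ^ 2 = x := by
    rw [hX, ← pow_mul, mul_comm, pow_mul, Real.sq_sqrt h0.le]
  set u := X / (2 * η) with hu
  have hu0 : 0 < u := by positivity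
  have e1 : -(x / (1 - r)) / 4 = -u ^ 2 := by
    rw [hu, ← hη2, ← hX2]; field_simp; norm_num
  rw [e1]
  have hE : 0 < Real.exp (-u ^ 2) := Real.exp_pos _
  have hEE : Real.exp (-u ^ 2) * Real.exp (u ^ 2) = 1 := by rw [← Real.exp_add]; simp
  have p1 := Real.pow_div_factorial_le_exp (u ^ 2) (by positivity) 1
  have p2 := Real.pow_div_factorial_le_exp (u ^ 2) (by positivity) 2
  have p3 := Real.pow_div_factorial_le_exp (u ^ 2) (by positivity) 3
  norm_num [Nat.factorial] at p1 p2 p3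
  have q3 : u ^ 3 ≤ 3 / 2 * Real.exp (u ^ 2) := by nlinarith [sq_nonneg (u * (u - 1))]
  have q5 : u ^ 5 ≤ 4 * Real.exp (u ^ 2) := by nlinarith [sq_nonneg (u ^ 2 * (u - 1))]
  have w3 : Real.exp (-u ^ 2) * u ^ 3 ≤ 3 / 2 := by
    have := mul_le_mul_of_nonneg_left q3 hE.le
    linarith
  have w5 : Real.exp (-u ^ 2) * u ^ 5 ≤ 4 := by
    have := mul_le_mul_of_nonneg_left q5 hE.le
    linarith
  have hXu : X = 2 * η * u := by rw [hu]; field_simp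
  have t1 : x ^ 2 / (1 - x ^ 2) ≤ x ^ 2 + x ^ 3 / η ^ 2 := by
    have : x ^ 2 / (1 - x ^ 2) ≤ x ^ 2 / (1 - x) :=
      div_le_div_of_nonneg_left (by positivity) (by linarith) (by nlinarith)
    have h2 : x ^ 2 / (1 - x) = x ^ 2 + x ^ 3 / (1 - x) := by
      have : 1 - x ≠ 0 := by linarith
      field_simp; ring
    have h3 : x ^ 3 / (1 - x) ≤ x ^ 3 / η ^ 2 :=
      div_le_div_of_nonneg_left (by positivity) (by positivity) (by rw [hη2]; linarith)
    linarith
  have t2 : x ^ 2 * Real.exp (-u ^ 2) ≤ 12 * η ^ 3 * X := by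
    have : x ^ 2 * Real.exp (-u ^ 2) = 8 * η ^ 3 * X * (Real.exp (-u ^ 2) * u ^ 3) := by
      rw [← hX2]
      have : (X ^ 2) ^ 2 = X * X ^ 3 := by ring
      rw [this]
      nth_rewrite 2 [hXu]
      ring
    rw [this]
    calc _ ≤ 8 * η ^ 3 * X * (3 / 2) := by gcongr
      _ = _ := by ring
  have t3 : x ^ 3 / η ^ 2 * Real.exp (-u ^ 2) ≤ 128 * η ^ 3 * X := by
    have : x ^ 3 / η ^ 2 * Real.exp (-u ^ 2) = 32 * η ^ 3 * X * (Real.exp (-u ^ 2) * u ^ 5) := by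
      rw [← hX2]
      have : (X ^ 2) ^ 3 = X * X ^ 5 := by ring
      rw [this]
      nth_rewrite 2 [hXu]
      field_simp
      ring
    rw [this]
    calc _ ≤ 32 * η ^ 3 * X * 4 := by gcongr
      _ = _ := by ring
  calc _ ≤ (x ^ 2 + x ^ 3 / η ^ 2) * Real.exp (-u ^ 2) := by gcongr
    _ = x ^ 2 * Real.exp (-u ^ 2) + x ^ 3 / η ^ 2 * Real.exp (-u ^ 2) := by ring
    _ ≤ _ := by linarith

lemma even_gf {q : ℂ} (h0 : 0 < ‖q‖) (hq : ‖q‖ < 1) :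
    HasSum (fun n => (paE Even n : ℂ) * q ^ n)
      (∑' m, (q ^ (m + 1)) ^ 2 / (1 - (q ^ (m + 1)) ^ 2) * PP q m) ∧
    Summable (fun n => (paE Even n : ℝ) * ‖q‖ ^ n) := by
  refine hasSum_paE (g := fun x => x ^ 2 / (1 - x ^ 2)) hq (fun x hx => hasSum_even hx) ?_
  have h : Summable (fun m => (‖q‖ ^ (m + 1)) ^ 2 / (1 - (‖q‖ ^ (m + 1)) ^ 2) * PR ‖q‖ m) := by
    refine Summable.of_nonneg_of_le (fun m => ?_) (fun m => ?_) (summable_PR_diff h0 hq)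
    all_goals
      obtain ⟨a, b, -, -⟩ := pow_facts h0 hq (k := m + 1) (by omega)
      have hP := PR_pos h0 hq m
      have h2 : 0 < 1 - (‖q‖ ^ (m + 1)) ^ 2 := by nlinarith
    · positivity
    · gcongr
      nlinarith
  rw [← Complex.summable_ofReal] at h
  convert! h using 1
  ext m
  rw [PP_ofReal]; push_cast; rfl

lemma even_bound {r θ : ℝ} (h0 : 0 < r) (h1 : r < 1) :
    ‖∑' k, (paE Even k : ℂ) * ((r : ℂ) * Complex.exp (θ * Complex.I)) ^ k‖ ≤
      280 * Real.sqrt (1 - r) * FR r * Real.exp (-(SS r θ) / 8) := by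
  set q := (r : ℂ) * Complex.exp (θ * Complex.I) with hq
  have hn : ‖q‖ = r := by
    rw [hq, norm_mul, Complex.norm_exp_ofReal_mul_I, mul_one, Complex.norm_real,
      Real.norm_of_nonneg h0.le]
  rw [(even_gf (by rwa [hn]) (by rwa [hn])).1.tsum_eq]
  have hF : 0 < FR r := by linarith [FR_ge_one h0]
  set ρ := Real.sqrt r with hρ
  have hρ0 : 0 < ρ := Real.sqrt_pos.2 h0
  have hρ2 : ρ ^ 2 = r := Real.sq_sqrt h0.le
  have hρ1 : ρ < 1 := by nlinarith
  have hη2 : Real.sqrt (1 - r) ^ 2 = 1 - r := Real.sq_sqrt (by linarith)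
  have hη0 : 0 < Real.sqrt (1 - r) := Real.sqrt_pos.2 (by linarith)
  set η := Real.sqrt (1 - r) with hη
  have hgeo : HasSum (fun m : ℕ => FR r * Real.exp (-(SS r θ) / 8) * (140 * η ^ 3 * ρ ^ (m + 1)))
      (FR r * Real.exp (-(SS r θ) / 8) * (140 * η ^ 3 * (ρ * (1 - ρ)⁻¹))) := by
    have := (hasSum_geometric_of_lt_one hρ0.le hρ1).mul_left ρ
    have := (this.mul_left (140 * η ^ 3)).mul_left (FR r * Real.exp (-(SS r θ) / 8))
    simpa only [pow_succ'] using this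
  refine (tsum_of_norm_bounded hgeo fun m => ?_).trans ?_
  · rw [norm_mul, norm_div, norm_pow, norm_pow, hn]
    obtain ⟨a, b, -, -⟩ := pow_facts h0 h1 (k := m + 1) (by omega)
    have h2 : 0 < 1 - (r ^ (m + 1)) ^ 2 := by nlinarith
    have h3 : 1 - (r ^ (m + 1)) ^ 2 ≤ ‖1 - (q ^ (m + 1)) ^ 2‖ := by
      have := norm_sub_norm_le (1 : ℂ) ((q ^ (m + 1)) ^ 2)
      simpa [norm_pow, hn] using this
    have h4 := norm_PP_le (θ := θ) h0 h1 m
    rw [← hq] at h4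
    calc _ ≤ (r ^ (m + 1)) ^ 2 / (1 - (r ^ (m + 1)) ^ 2) * (FR r * Real.exp (-(SS r θ) / 8) *
          Real.exp (-(r ^ (m + 1) / (1 - r)) / 4)) := by gcongr
      _ = FR r * Real.exp (-(SS r θ) / 8) * ((r ^ (m + 1)) ^ 2 / (1 - (r ^ (m + 1)) ^ 2) *
          Real.exp (-(r ^ (m + 1) / (1 - r)) / 4)) := by ring
      _ ≤ _ := mul_le_mul_of_nonneg_left (eps_term h0 h1 m) (by positivity)
  · have h5 : η ^ 2 * (ρ * (1 - ρ)⁻¹) ≤ 2 := by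
      rw [hη2, ← hρ2, ← div_eq_mul_inv, ← mul_div_assoc, div_le_iff₀ (by linarith)]
      nlinarith [mul_pos hρ0 (by linarith : 0 < 1 - ρ)]
    calc _ = 140 * η * FR r * Real.exp (-(SS r θ) / 8) * (η ^ 2 * (ρ * (1 - ρ)⁻¹)) := by ring
      _ ≤ 140 * η * FR r * Real.exp (-(SS r θ) / 8) * 2 := by gcongr
      _ = _ := by ring

lemma even_coef {s : ℝ} (hs : 0 < s) (hs1 : s ≤ 1) (n : ℕ) :
    (paE Even n : ℝ) * Real.exp (-s ^ 2) ^ n / (FR (Real.exp (-s ^ 2)) * s ^ 3) ≤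
      140 * 528 * 360 ^ 3 * s := by
  set r := Real.exp (-s ^ 2) with hr
  have hF := FR_exp_pos s
  rw [← hr] at hF
  have h1 : r < 1 := exp_sq_lt hs
  have h0 : 0 < r := Real.exp_pos _
  have hsum : Summable (fun n => (paE Even n : ℝ) * r ^ n) := by
    have := (even_gf (q := (r : ℂ)) (by simpa using h0.ne') (by simpa [abs_of_pos h0] using h1)).2
    simpa [abs_of_pos h0] using this
  have h := fourier_coef (c := fun n => (paE Even n : ℂ)) h0 (by simpa using hsum) n
  have hη : Real.sqrt (1 - r) ≤ s := by
    rw [Real.sqrt_le_left hs.le]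
    have := Real.add_one_le_exp (-s ^ 2); linarith
  have hpi := Real.pi_pos
  have hb := intervalIntegral.norm_integral_le_of_norm_le (μ := MeasureTheory.volume)
    (a := -Real.pi) (b := Real.pi)
    (f := fun θ : ℝ => (∑' k, (paE Even k : ℂ) * ((r : ℂ) * Complex.exp (θ * Complex.I)) ^ k) *
      Complex.exp (-(n * θ * Complex.I)))
    (g := fun θ : ℝ => 280 * s * FR r * (528 * 360 ^ 3) * (1 + (θ / s ^ 3) ^ 2)⁻¹)
    (by linarith)
    (Eventually.of_forall fun θ hθ => by
      have e : -((n : ℂ) * θ * Complex.I) = ((-(n * θ) : ℝ) : ℂ) * Complex.I := by push_cast; ring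
      rw [norm_mul, e, Complex.norm_exp_ofReal_mul_I, mul_one]
      have e2 : s ^ 3 * (θ / s ^ 3) = θ := by field_simp
      have hd := decay (s := s) (y := θ / s ^ 3) hs hs1
        (by rw [e2]; exact abs_le.2 ⟨hθ.1.le, hθ.2⟩)
      rw [e2, ← hr] at hd
      refine (even_bound h0 h1).trans ?_
      rw [mul_assoc (280 * s * FR r)]
      gcongr)
    (by
      apply Continuous.intervalIntegrable
      refine continuous_const.mul (Continuous.inv₀ (by fun_prop) fun θ => ?_)
      positivity)
  rw [h, intervalIntegral.integral_const_mul,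
    intervalIntegral.integral_comp_div (fun x => (1 + x ^ 2)⁻¹) (by positivity : s ^ 3 ≠ 0),
    integral_inv_one_add_sq, smul_eq_mul] at hb
  have ha : Real.arctan (Real.pi / s ^ 3) - Real.arctan (-Real.pi / s ^ 3) ≤ Real.pi := by
    have := Real.arctan_lt_pi_div_two (Real.pi / s ^ 3)
    have := Real.neg_pi_div_two_lt_arctan (-Real.pi / s ^ 3)
    linarith
  have hl : ‖2 * (Real.pi : ℂ) * (paE Even n : ℂ) * (r : ℂ) ^ n‖ = 2 * Real.pi * paE Even n * r ^ n := by
    simp [abs_of_pos h0, abs_of_pos hpi]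
  rw [hl] at hb
  rw [div_le_iff₀ (by positivity)]
  have hb2 : 2 * Real.pi * paE Even n * r ^ n ≤ 280 * s * FR r * (528 * 360 ^ 3) * (s ^ 3 * Real.pi) :=
    hb.trans (by gcongr)
  have : 2 * Real.pi * ((paE Even n : ℝ) * r ^ n) ≤
      2 * Real.pi * (140 * 528 * 360 ^ 3 * s * (FR r * s ^ 3)) := by linarith
  exact le_of_mul_le_mul_left this (by positivity)


/-- The saddle point scale. -/
noncomputable def sn (n : ℕ) : ℝ := Real.sqrt (Real.sqrt (AA / n))

lemma sn_pos {n : ℕ} (hn : 0 < n) : 0 < sn n := by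
  have : (0 : ℝ) < n := by exact_mod_cast hn
  have := AA_pos
  exact Real.sqrt_pos.2 (Real.sqrt_pos.2 (by positivity))

lemma sn_sq (n : ℕ) : sn n ^ 2 = Real.sqrt (AA / n) := Real.sq_sqrt (Real.sqrt_nonneg _)

lemma sn_four (n : ℕ) : sn n ^ 4 = AA / n := by
  have := AA_pos
  rw [show sn n ^ 4 = (sn n ^ 2) ^ 2 by ring, sn_sq, Real.sq_sqrt (by positivity)]

lemma sn_tendsto : Tendsto sn atTop (𝓝[>] 0) := by
  refine tendsto_nhdsWithin_iff.2 ⟨?_, ?_⟩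
  · have h1 : Tendsto (fun n : ℕ => AA / (n : ℝ)) atTop (𝓝 0) := tendsto_const_div_atTop_nhds_zero_nat _
    have h2 := (Real.continuous_sqrt.tendsto 0).comp h1
    rw [Real.sqrt_zero] at h2
    have h3 := (Real.continuous_sqrt.tendsto 0).comp h2
    rw [Real.sqrt_zero] at h3
    exact h3
  · filter_upwards [eventually_gt_atTop 0] with n hn
    exact sn_pos hn

/-- Normalized coefficient. -/
noncomputable def nc (n : ℕ) : ℝ :=
  cf n * Real.exp (-sn n ^ 2) ^ n / (FR (Real.exp (-sn n ^ 2)) * sn n ^ 3)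

lemma nc_tendsto : Tendsto nc atTop (𝓝 (Real.sqrt (Real.pi / AA) / (2 * Real.pi))) := by
  have h := int_tendsto.comp sn_tendsto
  have h2 : Tendsto (fun n => ((2 * Real.pi * nc n : ℝ) : ℂ)) atTop
      (𝓝 (Real.sqrt (Real.pi / AA) : ℂ)) := by
    refine h.congr' ?_
    filter_upwards [eventually_gt_atTop 0] with n hn
    have hn' : (0 : ℝ) < n := by exact_mod_cast hn
    exact cf_int (sn_pos hn) (by rw [sn_four]; field_simp)
  have h3 := (Complex.continuous_re.tendsto _).comp h2
  have h4 : Tendsto (fun n => 2 * Real.pi * nc n) atTop (𝓝 (Real.sqrt (Real.pi / AA))) := h3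
  have h5 := h4.div_const (2 * Real.pi)
  refine h5.congr fun n => ?_
  have := Real.pi_pos
  field_simp

lemma main_asymp : Tendsto (fun n : ℕ => (paOdd n : ℝ) /
        (Real.sqrt AA / (2 * Real.pi * n) * Real.exp (2 * Real.sqrt (AA * n)))) atTop (𝓝 1) := by
  have hA := AA_pos
  have hpi := Real.pi_pos
  have hsq : Tendsto (fun n => sn n ^ 2) atTop (𝓝[>] 0) := by
    refine tendsto_nhdsWithin_iff.2 ⟨?_, ?_⟩
    · have := ((tendsto_nhdsWithin_iff.1 sn_tendsto).1).pow 2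
      simpa using this
    · filter_upwards [eventually_gt_atTop 0] with n hn
      exact pow_pos (sn_pos hn) 2
  have h := (nc_tendsto.mul (FR_asymp.comp hsq)).mul_const (2 * Real.sqrt Real.pi * Real.sqrt AA)
  have e : Real.sqrt (Real.pi / AA) / (2 * Real.pi) * 1 * (2 * Real.sqrt Real.pi * Real.sqrt AA) = 1 := by
    rw [Real.sqrt_div hpi.le]
    have h1 : Real.sqrt AA ≠ 0 := (Real.sqrt_pos.2 hA).ne'
    have h2 : Real.sqrt Real.pi ^ 2 = Real.pi := Real.sq_sqrt hpi.le
    field_simp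
    linarith
  rw [e] at h
  refine h.congr' ?_
  filter_upwards [eventually_gt_atTop 0] with n hn
  have hn' : (0 : ℝ) < n := by exact_mod_cast hn
  have hs := sn_pos hn
  have e1 : (n : ℝ) * sn n ^ 2 = Real.sqrt (AA * n) := by
    rw [sn_sq, Real.sqrt_div hA.le, Real.sqrt_mul hA.le]
    have h1 : Real.sqrt (n : ℝ) ^ 2 = n := Real.sq_sqrt hn'.le
    have h2 : Real.sqrt (n : ℝ) ≠ 0 := (Real.sqrt_pos.2 hn').ne'
    field_simp
    linarith
  have e4 := sn_four n
  have e2 : AA / sn n ^ 2 = Real.sqrt (AA * n) := by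
    rw [← e1, div_eq_iff (by positivity), mul_assoc, ← pow_add, e4]
    field_simp
  have e3 : Real.sqrt (sn n ^ 2 / Real.pi) = sn n / Real.sqrt Real.pi := by
    rw [Real.sqrt_div (by positivity), Real.sqrt_sq hs.le]
  have e5 : Real.exp (-sn n ^ 2) ^ n = (Real.exp (Real.sqrt (AA * n)))⁻¹ := by
    rw [← Real.exp_nat_mul, ← e1, ← Real.exp_neg]; congr 1; ring
  have e6 : Real.exp (2 * Real.sqrt (AA * n)) = Real.exp (Real.sqrt (AA * n)) ^ 2 := by
    rw [← Real.exp_nat_mul]; norm_num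
  have hF := FR_exp_pos (sn n)
  simp only [Function.comp_def, nc]
  rw [e2, e3, e5, e6, paOdd_eq, cf_pos_eq hn]
  have hE := Real.exp_pos (Real.sqrt (AA * n))
  generalize Real.exp (Real.sqrt (AA * n)) = E at *
  have hp0 : 0 < Real.sqrt Real.pi := Real.sqrt_pos.2 hpi
  have hp2 : Real.sqrt Real.pi ^ 2 = Real.pi := Real.sq_sqrt hpi.le
  have ha0 : 0 < Real.sqrt AA := Real.sqrt_pos.2 hA
  have ha2 : Real.sqrt AA ^ 2 = AA := Real.sq_sqrt hA.le
  have e7 : sn n ^ 4 * n = Real.sqrt AA ^ 2 := by rw [e4, ha2]; field_simp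
  generalize sn n = s at *
  generalize FR (Real.exp (-s ^ 2)) = F at *
  rw [← hp2]
  generalize Real.sqrt Real.pi = p at *
  generalize Real.sqrt AA = a at *
  clear e1 e2 e3 e4 e5 e6
  have e8 : (n : ℝ) = a ^ 2 / s ^ 4 := by field_simp; linarith
  rw [e8]
  field_simp
  rw [Real.sqrt_sq hp0.le]

lemma ratio_asymp : Tendsto (fun n : ℕ => (paOdd n : ℝ) / (pa n : ℝ)) atTop (𝓝 1) := by
  have hL : 0 < Real.sqrt (Real.pi / AA) / (2 * Real.pi) := by
    have := AA_pos
    have := Real.pi_pos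
    have := Real.sqrt_pos.2 (div_pos Real.pi_pos AA_pos)
    positivity
  set ec : ℕ → ℝ := fun n => (paE Even n : ℝ) * Real.exp (-sn n ^ 2) ^ n /
    (FR (Real.exp (-sn n ^ 2)) * sn n ^ 3) with hec
  have h1 : ∀ᶠ n in atTop, sn n < 1 :=
    (tendsto_nhdsWithin_iff.1 sn_tendsto).1.eventually (gt_mem_nhds one_pos)
  have hz : Tendsto ec atTop (𝓝 0) := by
    have h2 := (tendsto_nhdsWithin_iff.1 sn_tendsto).1.const_mul (140 * 528 * 360 ^ 3)
    rw [mul_zero] at h2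
    refine squeeze_zero' ?_ ?_ h2
    · filter_upwards [eventually_gt_atTop 0] with n hn
      have := sn_pos hn
      have := FR_exp_pos (sn n)
      simp only [hec]; positivity
    · filter_upwards [eventually_gt_atTop 0, h1] with n hn h1
      exact even_coef (sn_pos hn) h1.le n
  have h3 := nc_tendsto.div (nc_tendsto.add hz) (by rw [add_zero]; exact hL.ne')
  rw [add_zero, div_self hL.ne'] at h3
  refine h3.congr' ?_
  filter_upwards [eventually_gt_atTop 0] with n hn
  have hs := sn_pos hn
  have hF := FR_exp_pos (sn n)
  simp only [Pi.div_apply, hec, nc]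
  rw [pa_eq hn, paOdd_eq, cf_pos_eq hn, ← add_div, ← add_mul]
  push_cast
  rw [div_div_div_cancel_right₀ (by positivity), mul_div_mul_right _ _ (by positivity)]

theorem paOdd_asymptotic (A : ℝ)
    (hA : A = Real.pi ^ 2 / 12 + 2 * Real.log ((1 + Real.sqrt 5) / 2) ^ 2) :
    Tendsto (fun n : ℕ => (paOdd n : ℝ) /
        (Real.sqrt A / (2 * Real.pi * n) * Real.exp (2 * Real.sqrt (A * n))))
      atTop (𝓝 1) ∧
    Tendsto (fun n : ℕ => (paOdd n : ℝ) / (pa n : ℝ)) atTop (𝓝 1) := by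
  have hA2 : A = AA := hA
  subst hA2
  exact ⟨main_asymp, ratio_asymp⟩
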